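/- The following statements are equivalent: (a) S satisfies right (◊); (b) there does not exist a uniserial right T-module of composition length 2 whose socle is a type (B) simple module and whose simple image is of type (C); (c) there does not exist a uniserial left T-module of composition length 2 whose socle is a type (C) simple module and whose simple image is of type (B); (d) there does not exist a cyclic 1-critical left S-module with an infinite-dimensional simple image; (e) for all irreducible elements b, c of S with b of type (B) and c of type (C), there exist irreducible elements b', c' of S, respectively of type (B) and type (C) and respectively similar (in T) to b and to c, such that cb = b'c'. -/

import Mathlib

open MulOpposite

universe u

/-- `φ : R →+* S` and `θ : S` exhibit `S` as the skew polynomial ring `R[θ; α]`: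
`θ · r = α(r) · θ`, and every element of `S` is uniquely a polynomial `Σ rᵢ θ^i`. -/
structure IsSkewPolynomialRing {R S : Type u} [CommRing R] [Ring S]
    (α : R ≃+* R) (φ : R →+* S) (θ : S) : Prop where
  commutes : ∀ r : R, θ * φ r = φ (α r) * θ
  bijective : Function.Bijective fun p : ℕ →₀ R => p.sum fun n r => φ r * θ ^ n

/-- `ψ : S →+* T` exhibits `T` as the (Ore) localization of `S` inverting the
powers of the normal element `x`. -/
structure IsLocalizationAt {S T : Type u} [Ring S] [Ring T] (x : S) (ψ : S →+* T) : Prop where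
  inj : Function.Injective ψ
  unit : IsUnit (ψ x)
  surj : ∀ t : T, ∃ (s : S) (n : ℕ), t * ψ x ^ n = ψ s

/-- The right ideal `zS`. -/
abbrev rSpan (S : Type u) [Ring S] (z : S) : Submodule Sᵐᵒᵖ S := Submodule.span Sᵐᵒᵖ {z}

/-- The left ideal `Sz`. -/
abbrev lSpan (S : Type u) [Ring S] (z : S) : Submodule S S := Submodule.span S {z}

/-- The cyclic right `S`-module `S/zS`. -/
abbrev rQuot (S : Type u) [Ring S] (z : S) : Type u := S ⧸ rSpan S z

/-- The cyclic left `S`-module `S/Sz`. -/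
abbrev lQuot (S : Type u) [Ring S] (z : S) : Type u := S ⧸ lSpan S z

/-- The cyclic right `S`-module `S/(aS + bS)`. -/
abbrev rQuot2 (S : Type u) [Ring S] (a b : S) : Type u := S ⧸ (rSpan S a ⊔ rSpan S b)

/-- Two elements of `T` are similar if `T/aT ≅ T/bT` as right `T`-modules. -/
def SimilarIn (T : Type u) [Ring T] (a b : T) : Prop :=
  Nonempty (rQuot T a ≃ₗ[Tᵐᵒᵖ] rQuot T b)

/-- The image in `S` of a polynomial `p ∈ k[θ]`, i.e. `Σ φ(pᵢ) θ^i`. -/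
def thetaPoly {k R S : Type u} [CommSemiring k] [CommRing R] [Ring S] [Algebra k R]
    (φ : R →+* S) (θ : S) (p : Polynomial k) : S :=
  p.sum fun n c => φ (algebraMap k R c) * θ ^ n

/-- Type (A) irreducibles of `S = R[θ; α]`: unit multiples of `X` or `θ`. -/
def IsTypeA {R S : Type u} [CommRing R] [Ring S] (X : R) (φ : R →+* S) (θ : S) (z : S) : Prop :=
  ∃ u : Sˣ, (u : S) * z = φ X ∨ (u : S) * z = θ

/-- Type (B) irreducibles of `S = R[θ; α]`: unit multiples of `1 + Xs`, `s ∈ S∖R`. -/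
def IsTypeB {R S : Type u} [CommRing R] [Ring S] (X : R) (φ : R →+* S) (z : S) : Prop :=
  ∃ (u : Sˣ) (s : S), s ∉ Set.range φ ∧ (u : S) * z = 1 + φ X * s

/-- Type (C) irreducibles of `S = R[θ; α]`: unit multiples of `f + Xs` with
`f ∈ k[θ]∖k` monic and the element not equal to `θ`. -/
def IsTypeC (k : Type u) {R S : Type u} [CommSemiring k] [CommRing R] [Ring S] [Algebra k R]
    (X : R) (φ : R →+* S) (θ : S) (z : S) : Prop :=
  ∃ (u : Sˣ) (p : Polynomial k) (s : S), p.Monic ∧ 1 ≤ p.natDegree ∧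
    (u : S) * z = thetaPoly φ θ p + φ X * s ∧ (u : S) * z ≠ θ

/-- A module is locally Artinian if all its finitely generated submodules are Artinian. -/
def IsLocallyArtinian (A M : Type u) [Ring A] [AddCommGroup M] [Module A M] : Prop :=
  ∀ N : Submodule A M, N.FG → IsArtinian A N

/-- A submodule is essential if it meets every nonzero submodule nontrivially. -/
def IsEssentialSubmodule {A : Type u} [Ring A] {E : Type u} [AddCommGroup E] [Module A E]
    (U : Submodule A E) : Prop :=
  ∀ W : Submodule A E, W ≠ ⊥ → W ⊓ U ≠ ⊥

/-- `f : V →ₗ[A] E` exhibits `E` as an injective hull of `V`. -/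
def IsInjectiveHullVia (A : Type u) [Ring A] {V E : Type u} [AddCommGroup V] [Module A V]
    [AddCommGroup E] [Module A E] (f : V →ₗ[A] E) : Prop :=
  Module.Injective A E ∧ Function.Injective f ∧ IsEssentialSubmodule (LinearMap.range f)

/-- Property (◊) for left `A`-modules: the injective hull of every simple left `A`-module
is locally Artinian.  (Apply with `A = Sᵐᵒᵖ` for the right-module version.) -/
def HasDiamond (A : Type u) [Ring A] : Prop :=
  ∀ (V E : Type u) [AddCommGroup V] [Module A V] [AddCommGroup E] [Module A E]
    (f : V →ₗ[A] E), IsSimpleModule A V → IsInjectiveHullVia A f → IsLocallyArtinian A E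

/-- Gabriel–Rentschler Krull dimension at most `n`; the base case `n = 0` is
`Artinian`, and `Kdim M ≤ n + 1` iff in every descending chain of submodules almost
all successive factors have Krull dimension at most `n`. -/
def KdimLE (A : Type u) [Ring A] : ℕ → ∀ (M : Type u) [AddCommGroup M] [Module A M], Prop
  | 0, M, _, _ => IsArtinian A M
  | n + 1, M, _, _ =>
      ∀ f : ℕ → Submodule A M, (∀ i, f (i + 1) ≤ f i) →
        ∃ N : ℕ, ∀ i, N ≤ i →
          KdimLE A n (↥(f i) ⧸ Submodule.comap (f i).subtype (f (i + 1)))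

/-- A `1`-critical module: Krull dimension exactly `1`, and all proper factors of
Krull dimension `< 1`, i.e. Artinian. -/
def IsOneCritical (A : Type u) [Ring A] (M : Type u) [AddCommGroup M] [Module A M] : Prop :=
  KdimLE A 1 M ∧ ¬ IsArtinian A M ∧ ∀ N : Submodule A M, N ≠ ⊥ → IsArtinian A (M ⧸ N)

/-- A right `S`-module is `𝒳`-torsion free (`𝒳 = {xⁿ}`). -/
def IsXTorsionFree {S : Type u} [Ring S] (x : S) (M : Type u) [AddCommGroup M]
    [Module Sᵐᵒᵖ M] : Prop :=
  ∀ (m : M) (n : ℕ), op (x ^ n) • m = 0 → m = 0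

/-- A right `S`-module is `𝒳`-torsion (`𝒳 = {xⁿ}`). -/
def IsXTorsion {S : Type u} [Ring S] (x : S) (M : Type u) [AddCommGroup M]
    [Module Sᵐᵒᵖ M] : Prop :=
  ∀ m : M, ∃ n : ℕ, op (x ^ n) • m = 0

/-- The central embedding of `k` into `Sᵐᵒᵖ` coming from `k → R → S`. -/
def opScalars {k R S : Type u} [CommSemiring k] [CommRing R] [Ring S] [Algebra k R]
    (φ : R →+* S) : k →+* Sᵐᵒᵖ where
  toFun c := op (φ (algebraMap k R c))
  map_one' := by simp
  map_mul' x y := by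
    show op (φ (algebraMap k R (x * y))) = op (φ (algebraMap k R x)) * op (φ (algebraMap k R y))
    rw [mul_comm x y, map_mul, map_mul, op_mul]
  map_zero' := by simp
  map_add' x y := by
    show op (φ (algebraMap k R (x + y))) = op (φ (algebraMap k R x)) + op (φ (algebraMap k R y))
    rw [map_add, map_add, op_add]

/-- A right `S`-module is finite dimensional over the central subfield `k`. -/
def FinDimOver (k : Type u) {R S : Type u} [Field k] [CommRing R] [Ring S] [Algebra k R]
    (φ : R →+* S) (M : Type u) [AddCommGroup M] [Module Sᵐᵒᵖ M] : Prop :=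
  letI : Module k M := Module.compHom M (opScalars φ)
  Module.Finite k M

/-- A left `S`-module is finite dimensional over the central subfield `k`. -/
def FinDimOverLeft (k : Type u) {R S : Type u} [Field k] [CommRing R] [Ring S] [Algebra k R]
    (φ : R →+* S) (M : Type u) [AddCommGroup M] [Module S M] : Prop :=
  letI : Module k M := Module.compHom M (φ.comp (algebraMap k R))
  Module.Finite k M

/-- `Ext¹_A(U, V) = 0`: every short exact sequence `0 → V → Y → U → 0` splits. -/
def ExtVanish (A : Type u) [Ring A] (U V : Type u) [AddCommGroup U] [Module A U]
    [AddCommGroup V] [Module A V] : Prop :=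
  ∀ (Y : Type u) [AddCommGroup Y] [Module A Y] (i : V →ₗ[A] Y) (p : Y →ₗ[A] U),
    Function.Injective i → Function.Surjective p → LinearMap.range i = LinearMap.ker p →
    ∃ r : Y →ₗ[A] V, r.comp i = LinearMap.id

/-- The right `S`-module `V` is isomorphic, as an `S`-module, to the right `T`-module `Q`
(`T` an `S`-ring via `ψ`). -/
def SModIsoOfT {S T : Type u} [Ring S] [Ring T] (ψ : S →+* T)
    (V : Type u) [AddCommGroup V] [Module Sᵐᵒᵖ V]
    (Q : Type u) [AddCommGroup Q] [Module Tᵐᵒᵖ Q] : Prop :=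
  ∃ e : V ≃+ Q, ∀ (s : S) (v : V), e (op s • v) = op (ψ s) • e v

/-- Two modules are hull-similar: they contain nonzero isomorphic submodules
(equivalently, their injective hulls are isomorphic). -/
def HullSimilar (A : Type u) [Ring A] (M N : Type u) [AddCommGroup M] [Module A M]
    [AddCommGroup N] [Module A N] : Prop :=
  ∃ (P : Submodule A M) (Q : Submodule A N), P ≠ ⊥ ∧ Q ≠ ⊥ ∧ Nonempty (P ≃ₗ[A] Q)

/-- Restriction of scalars along `ψ : S →+* T` for right modules. -/
def restrictOp {S T : Type u} [Ring S] [Ring T] (ψ : S →+* T)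
    (E : Type u) [AddCommGroup E] [Module Tᵐᵒᵖ E] : Module Sᵐᵒᵖ E :=
  Module.compHom E (RingHom.op ψ)

/-- `f : V →+ E` exhibits `E` as an injective hull of the `A`-module `V`,
where `f` is additionally required to be `A`-linear. -/
def IsInjectiveHullViaAdd (A : Type u) [Ring A] {V E : Type u} [AddCommGroup V] [Module A V]
    [AddCommGroup E] [Module A E] (f : V →+ E) : Prop :=
  Module.Injective A E ∧ Function.Injective f ∧ (∀ (a : A) (v : V), f (a • v) = a • f v) ∧
    ∀ W : Submodule A E, W ≠ ⊥ → ∃ x : E, x ≠ 0 ∧ x ∈ W ∧ x ∈ Set.range f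

set_option linter.unusedSectionVars false

/-- Abstract data used in the proof: a domain `S` with a normal element `X`, `S/XS ≅ k[θ]`,
a localization `ψ : S → T` inverting `X`, and a degree function. -/
structure Setup {k S T : Type u} [Field k] [Ring S] [Algebra k S] [Ring T]
    (X : S) (π : S →ₐ[k] Polynomial k) (ψ : S →+* T) (d : S → ℕ) : Prop where
  surj : Function.Surjective π
  kerL : ∀ s, π s = 0 → ∃ t, s = X * t
  kerR : ∀ s, π s = 0 → ∃ t, s = t * X
  piX : π X = 0
  X0 : X ≠ 0
  val : ∀ s, s ≠ 0 → ∃ n, ∀ t, s ≠ X ^ n * t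
  dmul : ∀ a b, a ≠ 0 → b ≠ 0 → d (a * b) = d a + d b
  dunit : ∀ s, π s ≠ 0 → d s = 0 → IsUnit s
  inj : Function.Injective ψ
  unit : IsUnit (ψ X)
  locR : ∀ t : T, ∃ (s : S) (n : ℕ), t * ψ X ^ n = ψ s
  locL : ∀ t : T, ∃ (s : S) (n : ℕ), ψ X ^ n * t = ψ s
  euL : ∀ a b, b ≠ 0 → ∃ n q r, X ^ n * a = q * b + r ∧ (r = 0 ∨ d r < d b)
  euR : ∀ a b, b ≠ 0 → ∃ n q r, a * X ^ n = b * q + r ∧ (r = 0 ∨ d r < d b)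

namespace Setup

section
variable {k S T : Type u} [Field k] [Ring S] [Algebra k S] [Ring T] [IsDomain S] [IsDomain T]
    {X : S} {π : S →ₐ[k] Polynomial k} {ψ : S →+* T} {d : S → ℕ}

theorem normL (H : Setup X π ψ d) (s : S) : ∃ s', X * s = s' * X :=
  H.kerR _ (by rw [map_mul, H.piX, zero_mul])

theorem normR (H : Setup X π ψ d) (s : S) : ∃ s', s * X = X * s' :=
  H.kerL _ (by rw [map_mul, H.piX, mul_zero])

theorem normLp (H : Setup X π ψ d) (n : ℕ) (s : S) :
    ∃ s', X ^ n * s = s' * X ^ n ∧ (π s ≠ 0 → π s' ≠ 0) := by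
  induction n generalizing s with
  | zero => exact ⟨s, by simp⟩
  | succ n ih =>
    obtain ⟨s1, h1⟩ := H.normL s
    obtain ⟨s2, h2, h3⟩ := ih s1
    refine ⟨s2, ?_, fun hs => h3 fun h0 => hs ?_⟩
    · rw [pow_succ, mul_assoc, h1, ← mul_assoc, h2, mul_assoc]
    · obtain ⟨t, rfl⟩ := H.kerL _ h0
      have : s = t * X := mul_left_cancel₀ H.X0 (by rw [h1, mul_assoc])
      rw [this, map_mul, H.piX, mul_zero]

theorem normRp (H : Setup X π ψ d) (n : ℕ) (s : S) :
    ∃ s', s * X ^ n = X ^ n * s' ∧ (π s ≠ 0 → π s' ≠ 0) := by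
  induction n generalizing s with
  | zero => exact ⟨s, by simp⟩
  | succ n ih =>
    obtain ⟨s1, h1⟩ := H.normR s
    obtain ⟨s2, h2, h3⟩ := ih s1
    refine ⟨s2, ?_, fun hs => h3 fun h0 => hs ?_⟩
    · rw [pow_succ', ← mul_assoc, h1, mul_assoc, h2, mul_assoc]
    · obtain ⟨t, rfl⟩ := H.kerR _ h0
      have : s = X * t := mul_right_cancel₀ H.X0 (by rw [h1, mul_assoc])
      rw [this, map_mul, H.piX, zero_mul]

theorem toOp (H : Setup X π ψ d) :
    Setup (op X) (π.fromOpposite (fun _ _ => mul_comm _ _)) (RingHom.op ψ)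
      (fun s => d (unop s)) where
  surj := fun p => by obtain ⟨s, hs⟩ := H.surj p; exact ⟨.op s, hs⟩
  kerL := fun s hs => by
    obtain ⟨t, ht⟩ := H.kerR (unop s) hs
    exact ⟨.op t, unop_injective ht⟩
  kerR := fun s hs => by
    obtain ⟨t, ht⟩ := H.kerL (unop s) hs
    exact ⟨.op t, unop_injective ht⟩
  piX := H.piX
  X0 := fun h => H.X0 (op_injective h)
  val := fun s hs => by
    obtain ⟨n, hn⟩ := H.val (unop s) (fun h => hs (unop_injective h))
    refine ⟨n, fun t ht => ?_⟩
    obtain ⟨t', ht', -⟩ := H.normRp n (unop t)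
    apply hn t'
    rw [← ht', ht]; simp
  dmul := fun a b ha hb => by
    have := H.dmul (unop b) (unop a) (fun h => hb (unop_injective h))
      (fun h => ha (unop_injective h))
    simp only [unop_mul, this, add_comm]
  dunit := fun s h1 h2 => by
    have := H.dunit (unop s) h1 h2
    simpa using this
  inj := fun a b h => unop_injective (H.inj (op_injective h))
  unit := by simpa using H.unit
  locR := fun t => by
    obtain ⟨s, n, h⟩ := H.locL (unop t)
    exact ⟨.op s, n, unop_injective (by simpa using h)⟩
  locL := fun t => by
    obtain ⟨s, n, h⟩ := H.locR (unop t)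
    exact ⟨.op s, n, unop_injective (by simpa using h)⟩
  euL := fun a b hb => by
    obtain ⟨n, q, r, h, h'⟩ := H.euR (unop a) (unop b) (fun h => hb (unop_injective h))
    refine ⟨n, .op q, .op r, unop_injective (by simpa using h), ?_⟩
    simpa using h'
  euR := fun a b hb => by
    obtain ⟨n, q, r, h, h'⟩ := H.euL (unop a) (unop b) (fun h => hb (unop_injective h))
    refine ⟨n, .op q, .op r, unop_injective (by simpa using h), ?_⟩
    simpa using h'

theorem ne0 {s : S} (h : π s ≠ 0) : s ≠ 0 := fun h0 => h (by rw [h0, map_zero])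

theorem norm (H : Setup X π ψ d) {s : S} (hs : s ≠ 0) : ∃ n t, s = X ^ n * t ∧ π t ≠ 0 := by
  classical
  have h := H.val s hs
  have hn := Nat.find_spec h
  obtain ⟨m, hm⟩ : ∃ m, Nat.find h = m + 1 := by
    apply Nat.exists_eq_succ_of_ne_zero
    intro h0
    rw [h0] at hn
    exact hn s (by simp)
  have hm' := Nat.find_min h (m := m) (by omega)
  push Not at hm'
  obtain ⟨t, ht⟩ := hm'
  refine ⟨m, t, ht, fun h0 => ?_⟩
  obtain ⟨t', rfl⟩ := H.kerL _ h0
  rw [hm] at hn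
  exact hn t' (by rw [ht, pow_succ, mul_assoc])

/-- if `X^n` left-divides `s a` with `a` nonzero mod `X`, then it left-divides `s`. -/
theorem dvdX (H : Setup X π ψ d) {a : S} (ha : π a ≠ 0) (n : ℕ) (s t : S)
    (h : s * a = X ^ n * t) : ∃ s', s = X ^ n * s' ∧ s' * a = t := by
  induction n generalizing s t with
  | zero => exact ⟨s, by simp, by simpa using h⟩
  | succ n ih =>
    have h0 : π s = 0 := by
      have := congrArg π h
      rw [map_mul, map_mul, map_pow, H.piX, zero_pow (by simp), zero_mul] at this
      exact (mul_eq_zero.1 this).resolve_right ha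
    obtain ⟨s1, rfl⟩ := H.kerL _ h0
    have : s1 * a = X ^ n * t := mul_left_cancel₀ H.X0 (by
      rw [← mul_assoc, h, pow_succ', mul_assoc])
    obtain ⟨s', h1, h2⟩ := ih _ _ this
    exact ⟨s', by rw [h1, pow_succ', mul_assoc], h2⟩

theorem locmem (H : Setup X π ψ d) {a : S} (ha : π a ≠ 0) {t : T} {s : S}
    (h : t * ψ a = ψ s) : ∃ s', t = ψ s' ∧ s = s' * a := by
  obtain ⟨s0, n, h0⟩ := H.locL t
  have h1 : s0 * a = X ^ n * s := H.inj (by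
    rw [map_mul, ← h0, mul_assoc, h, map_mul, map_pow])
  obtain ⟨s', h2, h3⟩ := H.dvdX ha n _ _ h1
  refine ⟨s', ?_, h3.symm⟩
  have : ψ X ^ n ≠ 0 := (H.unit.pow n).ne_zero
  exact mul_left_cancel₀ this (by rw [h0, h2, map_mul, map_pow])

/-- extension of a left ideal to `T` -/
theorem ext_mem (H : Setup X π ψ d) (L : Submodule S S) {t : T}
    (ht : t ∈ Submodule.span T (ψ '' (L : Set S))) : ∃ n, ∃ s ∈ L, ψ X ^ n * t = ψ s := by
  induction ht using Submodule.span_induction with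
  | mem x hx => obtain ⟨s, hs, rfl⟩ := hx; exact ⟨0, s, hs, by simp⟩
  | zero => exact ⟨0, 0, L.zero_mem, by simp⟩
  | add x y _ _ hx hy =>
    obtain ⟨n, s, hs, h⟩ := hx
    obtain ⟨m, s', hs', h'⟩ := hy
    refine ⟨n + m, X ^ m * s + X ^ n * s', L.add_mem (L.smul_mem (X ^ m) hs)
      (L.smul_mem (X ^ n) hs'), ?_⟩
    rw [mul_add, map_add, map_mul, map_mul, map_pow, map_pow, ← h, ← h', ← mul_assoc,
      ← mul_assoc, ← pow_add, ← pow_add, add_comm m n]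
  | smul a x _ hx =>
    obtain ⟨n, s, hs, h⟩ := hx
    obtain ⟨a', m, ha⟩ := H.locL a
    obtain ⟨a'', ha', -⟩ := H.normLp n a'
    refine ⟨n + m, a'' * s, L.smul_mem a'' hs, ?_⟩
    have ha2 := congrArg ψ ha'
    rw [map_mul, map_mul, map_pow] at ha2
    rw [smul_eq_mul, pow_add, mul_assoc, ← mul_assoc _ a x, ha, ← mul_assoc, ha2, mul_assoc, h,
      map_mul]

theorem pid (H : Setup X π ψ d) (J : Submodule T T) :
    J = ⊥ ∨ ∃ a, π a ≠ 0 ∧ J = Submodule.span T {ψ a} := by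
  classical
  by_cases hJ : J = ⊥
  · exact Or.inl hJ
  right
  have hex : ∃ n, ∃ a, a ≠ 0 ∧ ψ a ∈ J ∧ d a = n := by
    obtain ⟨t, ht, h0⟩ := J.exists_mem_ne_zero_of_ne_bot hJ
    obtain ⟨s, n, h⟩ := H.locL t
    refine ⟨_, s, ?_, ?_, rfl⟩
    · rintro rfl
      rw [map_zero] at h
      exact (mul_eq_zero.1 h).elim (H.unit.pow n).ne_zero h0
    · rw [← h]; exact J.smul_mem _ ht
  obtain ⟨a, ha0, haJ, han⟩ := Nat.find_spec hex
  have hmin : ∀ r, r ≠ 0 → ψ r ∈ J → ¬ d r < d a := by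
    intro r h1 h2 h3
    exact Nat.find_min hex (m := d r) (by omega) ⟨r, h1, h2, rfl⟩
  obtain ⟨m, b, hb, hb0⟩ := H.norm ha0
  refine ⟨b, hb0, le_antisymm ?_ ?_⟩
  · intro t ht
    obtain ⟨s, n, h⟩ := H.locL t
    obtain ⟨n', q, r, h1, h2⟩ := H.euL s a ha0
    have hr : r = 0 := by
      by_contra hr
      refine hmin r hr ?_ (h2.resolve_left hr)
      have : r = X ^ n' * s - q * a := by rw [h1]; abel
      rw [this, map_sub, map_mul, map_mul, ← h]
      exact J.sub_mem (J.smul_mem _ (J.smul_mem _ ht)) (J.smul_mem _ haJ)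
    rw [hr, add_zero] at h1
    obtain ⟨u, hu⟩ := (H.unit.pow (n' + n))
    rw [Submodule.mem_span_singleton]
    refine ⟨(↑u⁻¹ : T) * ψ (q * X ^ m), ?_⟩
    rw [smul_eq_mul, mul_assoc, ← map_mul, mul_assoc, ← hb, ← h1, map_mul, ← h, map_pow,
      ← mul_assoc (ψ X ^ n'), ← pow_add, ← hu, Units.inv_mul_cancel_left]
  · rw [Submodule.span_singleton_le_iff_mem]
    obtain ⟨u, hu⟩ := (H.unit.pow m)
    have : ψ b = (↑u⁻¹ : T) * ψ a := by
      rw [hb, map_mul, map_pow, ← hu, Units.inv_mul_cancel_left]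
    rw [this]; exact J.smul_mem _ haJ

theorem mem_span (H : Setup X π ψ d) {a s : S} (ha : π a ≠ 0)
    (h : ψ s ∈ Submodule.span T {ψ a}) : ∃ w, s = w * a := by
  obtain ⟨t, ht⟩ := Submodule.mem_span_singleton.1 h
  obtain ⟨s', -, h2⟩ := H.locmem ha ht
  exact ⟨s', h2⟩

/-- structure of nonzero left ideals of `S` -/
theorem struct (H : Setup X π ψ d) (L : Submodule S S) (hL : L ≠ ⊥) :
    ∃ z n, π z ≠ 0 ∧ (∀ s ∈ L, ∃ w, s = w * z) ∧ X ^ n * z ∈ L := by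
  have hsub : ∀ s ∈ L, ψ s ∈ Submodule.span T (ψ '' (L : Set S)) :=
    fun s hs => Submodule.subset_span ⟨s, hs, rfl⟩
  rcases H.pid (Submodule.span T (ψ '' (L : Set S))) with h | ⟨z, hz, h⟩
  · exfalso; apply hL
    rw [eq_bot_iff]
    intro s hs
    have := hsub s hs
    rw [h, Submodule.mem_bot] at this
    rw [Submodule.mem_bot]
    exact H.inj (by rw [this, map_zero])
  · obtain ⟨n, s, hs, h'⟩ := H.ext_mem L (t := ψ z) (by
      rw [h]; exact Submodule.mem_span_singleton_self _)
    refine ⟨z, n, hz, fun s hs => H.mem_span hz (h ▸ hsub s hs), ?_⟩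
    rw [← map_pow, ← map_mul] at h'
    rwa [H.inj h']

end
end Setup

/-- irreducible, not divisible by `X`, and constant mod `X` iff `β` -/
def Typ {k S : Type u} [Field k] [Ring S] [Algebra k S] (π : S →ₐ[k] Polynomial k)
    (β : Prop) (z : S) : Prop :=
  Irreducible z ∧ π z ≠ 0 ∧ (IsUnit (π z) ↔ β)

/-- swapping property -/
def Fac {k S : Type u} [Field k] [Ring S] [Algebra k S] (π : S →ₐ[k] Polynomial k)
    (β : Prop) : Prop :=
  ∀ p q, Typ π β p → Typ π (¬ β) q →
    ∃ q' p', Typ π (¬ β) q' ∧ Typ π β p' ∧ p * q = q' * p'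

namespace Setup

section
variable {k S T : Type u} [Field k] [Ring S] [Algebra k S] [Ring T] [IsDomain S] [IsDomain T]
    {X : S} {π : S →ₐ[k] Polynomial k} {ψ : S →+* T} {d : S → ℕ}

theorem fin_quot (H : Setup X π ψ d) (L : Submodule S S) (hX : X ∈ L) {z : S} (hz : z ∈ L)
    (h0 : π z ≠ 0) : Module.Finite k (S ⧸ L) := by
  let I : Ideal (Polynomial k) := Ideal.span {π z}
  let g : S →ₗ[k] (Polynomial k ⧸ I) := (I.mkQ.restrictScalars k).comp π.toLinearMap
  have hg : Function.Surjective g := by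
    intro y
    obtain ⟨p, rfl⟩ := Submodule.mkQ_surjective I y
    obtain ⟨s, rfl⟩ := H.surj p
    exact ⟨s, rfl⟩
  obtain ⟨h, hh⟩ := g.exists_rightInverse_of_surjective (LinearMap.range_eq_top.2 hg)
  have hker : ∀ s, g s = 0 → s ∈ L := by
    intro s hs
    have : π s ∈ I := (Submodule.Quotient.mk_eq_zero I).1 hs
    obtain ⟨p, hp⟩ := Ideal.mem_span_singleton'.1 this
    obtain ⟨w, rfl⟩ := H.surj p
    obtain ⟨t, ht⟩ := H.kerR (s - w * z) (by rw [map_sub, map_mul, hp, sub_self])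
    have : s = w * z + t * X := by rw [← ht]; abel
    rw [this]
    exact L.add_mem (L.smul_mem _ hz) (L.smul_mem _ hX)
  have : Module.Finite k (Polynomial k ⧸ I) := (AdjoinRoot.powerBasis h0).finite
  refine Module.Finite.of_surjective ((L.mkQ.restrictScalars k).comp h) ?_
  intro y
  obtain ⟨s, rfl⟩ := Submodule.mkQ_surjective L y
  refine ⟨g s, ?_⟩
  change L.mkQ (h (g s)) = L.mkQ s
  rw [Submodule.mkQ_apply, Submodule.mkQ_apply, Submodule.Quotient.eq]
  apply hker
  rw [map_sub, sub_eq_zero]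
  exact LinearMap.congr_fun hh (g s)

end

theorem art_le {A : Type u} [Ring A] {L L' : Submodule A A} (h : L ≤ L')
    (ha : IsArtinian A (A ⧸ L)) : IsArtinian A (A ⧸ L') :=
  isArtinian_of_surjective _ (Submodule.factor h) (Submodule.factor_surjective h)

theorem art_top {A : Type u} [Ring A] : IsArtinian A (A ⧸ (⊤ : Submodule A A)) :=
  inferInstance

/-- the left ideal `{s : s q ∈ L}` -/
abbrev colon {A : Type u} [Ring A] (L : Submodule A A) (q : A) : Submodule A A :=
  L.comap (LinearMap.toSpanSingleton A A q)

theorem mem_colon {A : Type u} [Ring A] {L : Submodule A A} {q s : A} :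
    s ∈ colon L q ↔ s * q ∈ L := Iff.rfl

theorem art_ext {A : Type u} [Ring A] (L : Submodule A A) (q : A)
    (h1 : IsArtinian A (A ⧸ colon L q))
    (h2 : IsArtinian A (A ⧸ (L ⊔ Submodule.span A {q}))) : IsArtinian A (A ⧸ L) := by
  refine isArtinian_of_range_eq_ker
    ((colon L q).mapQ L (LinearMap.toSpanSingleton A A q) le_rfl)
    (Submodule.factor (le_sup_left : L ≤ L ⊔ Submodule.span A {q})) ?_
  ext y
  obtain ⟨s, rfl⟩ := Submodule.mkQ_surjective L y
  constructor
  · rintro ⟨x, hx⟩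
    obtain ⟨t, rfl⟩ := Submodule.mkQ_surjective _ x
    rw [← hx]
    change Submodule.Quotient.mk _ = _
    rw [Submodule.Quotient.mk_eq_zero]
    exact Submodule.mem_sup_right (Submodule.mem_span_singleton.2 ⟨t, rfl⟩)
  · intro h
    have : s ∈ L ⊔ Submodule.span A {q} := (Submodule.Quotient.mk_eq_zero _).1 h
    obtain ⟨l, hl, y, hy, rfl⟩ := Submodule.mem_sup.1 this
    obtain ⟨t, rfl⟩ := Submodule.mem_span_singleton.1 hy
    refine ⟨Submodule.Quotient.mk t, ?_⟩
    change Submodule.Quotient.mk (t • q) = Submodule.Quotient.mk (l + t • q)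
    rw [Submodule.Quotient.eq]
    simpa using hl

section
variable {k S T : Type u} [Field k] [Ring S] [Algebra k S] [Ring T] [IsDomain S] [IsDomain T]
    {X : S} {π : S →ₐ[k] Polynomial k} {ψ : S →+* T} {d : S → ℕ}

theorem art1 (H : Setup X π ψ d) (L : Submodule S S) (hX : X ∈ L) {z : S} (hz : z ∈ L)
    (h0 : π z ≠ 0) : IsArtinian S (S ⧸ L) := by
  have := H.fin_quot L hX hz h0
  exact isArtinian_of_tower k inferInstance

theorem art (H : Setup X π ψ d) (n : ℕ) : ∀ (L : Submodule S S), X ^ n ∈ L → ∀ {z : S}, z ∈ L →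
    π z ≠ 0 → IsArtinian S (S ⧸ L) := by
  induction n with
  | zero =>
    intro L hL z _ _
    have : L = ⊤ := (Ideal.eq_top_iff_one L).2 (by simpa using hL)
    rw [this]; exact art_top
  | succ n ih =>
    intro L hL z hz h0
    apply art_ext L (X ^ n)
    · obtain ⟨z', h1, h2⟩ := H.normLp n z
      refine H.art1 _ (z := z') ?_ ?_ (h2 h0)
      · rw [mem_colon, ← pow_succ']; exact hL
      · rw [mem_colon, ← h1]; exact L.smul_mem _ hz
    · exact ih _ (Submodule.mem_sup_right (Submodule.mem_span_singleton_self _))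
        (Submodule.mem_sup_left hz) h0

theorem fg1 (H : Setup X π ψ d) (L : Submodule S S) (hX : X ∈ L) : L.FG := by
  classical
  have : RingHomSurjective (π : S →+* Polynomial k) := ⟨H.surj⟩
  let I : Ideal (Polynomial k) := Ideal.map (π : S →+* Polynomial k) L
  have hI : ∀ p ∈ I, ∃ s ∈ L, π s = p := by
    intro p hp
    induction hp using Submodule.span_induction with
    | mem x hx => obtain ⟨s, hs, rfl⟩ := hx; exact ⟨s, hs, rfl⟩
    | zero => exact ⟨0, L.zero_mem, map_zero _⟩
    | add x y _ _ hx hy =>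
      obtain ⟨s, hs, rfl⟩ := hx
      obtain ⟨t, ht, rfl⟩ := hy
      exact ⟨s + t, L.add_mem hs ht, map_add _ _ _⟩
    | smul a x _ hx =>
      obtain ⟨s, hs, rfl⟩ := hx
      obtain ⟨t, rfl⟩ := H.surj a
      exact ⟨t * s, L.smul_mem _ hs, map_mul _ _ _⟩
  obtain ⟨a, ha, hπ⟩ := hI _ (Submodule.IsPrincipal.generator_mem I)
  refine ⟨{a, X}, le_antisymm ?_ ?_⟩
  · rw [Submodule.span_le]
    intro x hx
    simp only [Finset.coe_insert, Finset.coe_singleton, Set.mem_insert_iff,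
      Set.mem_singleton_iff] at hx
    rcases hx with rfl | rfl
    · exact ha
    · exact hX
  · intro s hs
    have : π s ∈ I := Ideal.mem_map_of_mem (π : S →+* Polynomial k) hs
    obtain ⟨p, hp⟩ := (Submodule.IsPrincipal.mem_iff_eq_smul_generator I).1 this
    obtain ⟨w, rfl⟩ := H.surj p
    rw [← hπ, smul_eq_mul, ← map_mul] at hp
    obtain ⟨t, ht⟩ := H.kerR (s - w * a) (by rw [map_sub, hp, sub_self])
    have : s = w * a + t * X := by rw [← ht]; abel
    rw [this]
    exact Submodule.add_mem _ (Submodule.smul_mem _ _ (Submodule.subset_span (by simp)))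
      (Submodule.smul_mem _ _ (Submodule.subset_span (by simp)))

theorem fgn (H : Setup X π ψ d) (n : ℕ) : ∀ (L : Submodule S S), X ^ n ∈ L → L.FG := by
  induction n with
  | zero =>
    intro L hL
    have : L = ⊤ := (Ideal.eq_top_iff_one L).2 (by simpa using hL)
    rw [this]
    exact Module.Finite.fg_top
  | succ n ih =>
    intro L hL
    let P : Submodule S S := Submodule.span S {X ^ n}
    have hker : LinearMap.ker P.mkQ = P := Submodule.ker_mkQ P
    apply Submodule.fg_of_fg_map_of_fg_inf_ker P.mkQ
    · have h1 : (L ⊔ P).FG := ih _ (Submodule.mem_sup_right (Submodule.mem_span_singleton_self _))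
      have h2 : (L ⊔ P).map P.mkQ = L.map P.mkQ := by
        have h3 : P.map P.mkQ = ⊥ := by
          rw [← le_bot_iff, Submodule.map_le_iff_le_comap]
          exact hker.ge
        rw [Submodule.map_sup, h3, sup_bot_eq]
      rw [← h2]; exact h1.map _
    · rw [hker]
      have h1 : (colon L (X ^ n)).FG := H.fg1 _ (by rw [mem_colon, ← pow_succ']; exact hL)
      have h2 : L ⊓ P = (colon L (X ^ n)).map (LinearMap.toSpanSingleton S S (X ^ n)) := by
        rw [Submodule.map_comap_eq, LinearMap.range_toSpanSingleton, inf_comm]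
      rw [h2]; exact h1.map _

theorem noeth (H : Setup X π ψ d) : IsNoetherianRing S := by
  rw [isNoetherianRing_iff_ideal_fg]
  intro L
  by_cases hL : L = ⊥
  · rw [hL]; exact Submodule.fg_bot
  obtain ⟨z, n, hz, h1, h2⟩ := H.struct L hL
  have h3 : (colon L z).FG := H.fgn n _ h2
  have h4 : L = (colon L z).map (LinearMap.toSpanSingleton S S z) := by
    rw [Submodule.map_comap_eq, LinearMap.range_toSpanSingleton, eq_comm, inf_eq_right]
    intro s hs
    obtain ⟨w, rfl⟩ := h1 s hs
    exact Submodule.mem_span_singleton.2 ⟨w, rfl⟩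
  rw [h4]; exact h3.map _

theorem nonart_core (H : Setup X π ψ d) {z : S} (hz : π z ≠ 0) {n : ℕ} {s w : S}
    (h : X ^ n = s * X ^ (n + 1) + w * z) : IsUnit (π z) := by
  obtain ⟨s', hs, -⟩ := H.normRp n s
  have h1 : w * z = X ^ n * (1 - s' * X) := by
    rw [mul_sub, mul_one, ← mul_assoc, ← hs, mul_assoc, ← pow_succ]
    exact eq_sub_of_add_eq' h.symm
  obtain ⟨w', -, h2⟩ := H.dvdX hz n _ _ h1
  have := congrArg π h2
  rw [map_mul, map_sub, map_one, map_mul, H.piX, mul_zero, sub_zero, mul_comm] at this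
  exact IsUnit.of_mul_eq_one _ this

theorem nonart (H : Setup X π ψ d) {z : S} (hz : π z ≠ 0) (hu : ¬ IsUnit (π z)) :
    ¬ IsArtinian S (S ⧸ Submodule.span S {z}) := by
  intro ha
  let Q := Submodule.span S {z}
  let f : ℕ →o (Submodule S (S ⧸ Q))ᵒᵈ :=
    ⟨fun n => OrderDual.toDual ((Submodule.span S {X ^ n}).map Q.mkQ), by
      apply monotone_nat_of_le_succ
      intro n
      apply Submodule.map_mono
      rw [Submodule.span_singleton_le_iff_mem, pow_succ']
      exact Submodule.mem_span_singleton.2 ⟨X, rfl⟩⟩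
  obtain ⟨n, hn⟩ := IsArtinian.monotone_stabilizes f
  have h1 : (Submodule.span S {X ^ n}).map Q.mkQ = (Submodule.span S {X ^ (n+1)}).map Q.mkQ :=
    hn (n + 1) (by omega)
  have h2 : Q.mkQ (X ^ n) ∈ (Submodule.span S {X ^ (n+1)}).map Q.mkQ := by
    rw [← h1]; exact Submodule.mem_map_of_mem (Submodule.mem_span_singleton_self _)
  obtain ⟨y, hy, h3⟩ := h2
  obtain ⟨s, rfl⟩ := Submodule.mem_span_singleton.1 hy
  rw [Submodule.mkQ_apply, Submodule.mkQ_apply, eq_comm, Submodule.Quotient.eq] at h3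
  obtain ⟨w, hw⟩ := Submodule.mem_span_singleton.1 h3
  refine hu (H.nonart_core hz (n := n) (s := s) (w := w) ?_)
  rw [smul_eq_mul, smul_eq_mul] at hw
  rw [hw]; abel

/-- an Artinian quotient on which X acts as zero comes from an ideal with nonzero image -/
theorem art_exists (H : Setup X π ψ d) (L : Submodule S S)
    (ha : IsArtinian S (S ⧸ (L ⊔ Submodule.span S {X}))) : ∃ z ∈ L, π z ≠ 0 := by
  by_contra hcon
  push Not at hcon
  obtain ⟨y, hy⟩ := H.surj Polynomial.X
  set Q := L ⊔ Submodule.span S {X} with hQ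
  let f : ℕ →o (Submodule S (S ⧸ Q))ᵒᵈ :=
    ⟨fun n => OrderDual.toDual ((Submodule.span S {y ^ n}).map Q.mkQ), by
      apply monotone_nat_of_le_succ
      intro n
      apply Submodule.map_mono
      rw [Submodule.span_singleton_le_iff_mem, pow_succ']
      exact Submodule.mem_span_singleton.2 ⟨y, rfl⟩⟩
  obtain ⟨n, hn⟩ := IsArtinian.monotone_stabilizes f
  have h1 : (Submodule.span S {y ^ n}).map Q.mkQ = (Submodule.span S {y ^ (n+1)}).map Q.mkQ :=
    hn (n + 1) (by omega)
  have h2 : Q.mkQ (y ^ n) ∈ (Submodule.span S {y ^ (n+1)}).map Q.mkQ := by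
    rw [← h1]; exact Submodule.mem_map_of_mem (Submodule.mem_span_singleton_self _)
  obtain ⟨y', hy', h3⟩ := h2
  obtain ⟨s, rfl⟩ := Submodule.mem_span_singleton.1 hy'
  rw [Submodule.mkQ_apply, Submodule.mkQ_apply, eq_comm, Submodule.Quotient.eq, hQ] at h3
  obtain ⟨l, hl, x, hx, h4⟩ := Submodule.mem_sup.1 h3
  obtain ⟨w, rfl⟩ := Submodule.mem_span_singleton.1 hx
  have h5 := congrArg π h4
  simp only [smul_eq_mul, map_add, map_mul, map_sub, map_pow, H.piX, mul_zero, add_zero,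
    hcon l hl, hy] at h5
  have h6 : (Polynomial.X : Polynomial k) ^ n * (1 - π s * Polynomial.X) = 0 := by
    rw [h5]; ring
  have h7 := (mul_eq_zero.1 h6).resolve_left (pow_ne_zero _ Polynomial.X_ne_zero)
  have h8 := congrArg (Polynomial.eval 0) h7
  simp at h8

theorem unit_of_mul (a b : S) (h : a * b = 1) : IsUnit a ∧ IsUnit b := by
  have h' : b * a = 1 := by
    have hb : b ≠ 0 := by rintro rfl; simp at h
    exact mul_right_cancel₀ hb (by rw [mul_assoc, h, one_mul, mul_one])
  exact ⟨⟨⟨a, b, h, h'⟩, rfl⟩, ⟨⟨b, a, h', h⟩, rfl⟩⟩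

theorem topX (H : Setup X π ψ d) (L : Submodule S S) {b : S} (hb : b ∈ L) (hu : IsUnit (π b))
    (n : ℕ) (hn : X ^ n ∈ L) : L = ⊤ := by
  induction n with
  | zero => exact (Ideal.eq_top_iff_one L).2 (by simpa using hn)
  | succ n ih =>
    apply ih
    obtain ⟨p, hp⟩ := hu.exists_left_inv
    obtain ⟨w, rfl⟩ := H.surj p
    obtain ⟨v, hv⟩ := H.kerR (1 - w * b) (by rw [map_sub, map_one, map_mul, hp, sub_self])
    obtain ⟨v', hv', -⟩ := H.normLp n v
    have : X ^ n = X ^ n * w * b + v' * X ^ (n + 1) := by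
      rw [pow_succ, ← mul_assoc, ← hv', mul_assoc (X ^ n) v, ← hv]
      noncomm_ring
    rw [this]
    exact L.add_mem (L.smul_mem _ hb) (L.smul_mem _ hn)

theorem powX_mem (H : Setup X π ψ d) (L : Submodule S S) {z : S} (hz : IsUnit z)
    {n : ℕ} (h : X ^ n * z ∈ L) : X ^ n ∈ L := by
  obtain ⟨y, hy⟩ := hz.exists_left_inv
  obtain ⟨y', h1, -⟩ := H.normLp n y
  have : X ^ n = y' * (X ^ n * z) := by
    rw [← mul_assoc, ← h1, mul_assoc, hy, mul_one]
  rw [this]; exact L.smul_mem _ h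

theorem span_unit_mul {u z : S} (hu : IsUnit u) :
    z ∈ Submodule.span S {u * z} := by
  obtain ⟨v, hv⟩ := hu.exists_left_inv
  exact Submodule.mem_span_singleton.2 ⟨v, by rw [smul_eq_mul, ← mul_assoc, hv, one_mul]⟩

theorem simpleB (H : Setup X π ψ d) {b : S} (hb : Irreducible b) (hu : IsUnit (π b)) :
    IsSimpleModule S (S ⧸ Submodule.span S {b}) := by
  rw [isSimpleModule_iff_isCoatom]
  constructor
  · intro h
    have : (1 : S) ∈ Submodule.span S {b} := by rw [h]; trivial
    obtain ⟨a, ha⟩ := Submodule.mem_span_singleton.1 this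
    exact hb.not_isUnit (unit_of_mul _ _ ha).2
  · intro L hL
    have hbL : b ∈ L := hL.le (Submodule.mem_span_singleton_self _)
    obtain ⟨z, n, hz, h1, h2⟩ := H.struct L (by
      rintro rfl; exact hb.ne_zero hbL)
    obtain ⟨w, rfl⟩ := h1 b hbL
    rcases hb.isUnit_or_isUnit rfl with h | h
    · exfalso
      apply hL.not_ge
      intro s hs
      obtain ⟨v, rfl⟩ := h1 s hs
      exact Submodule.smul_mem _ _ (span_unit_mul h)
    · exact H.topX L hbL hu n (H.powX_mem L h h2)

theorem deg_pos (H : Setup X π ψ d) {a : S} (ha : π a ≠ 0) (hu : ¬ IsUnit a) : 0 < d a := by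
  rcases Nat.eq_zero_or_pos (d a) with h | h
  · exact absurd (H.dunit a ha h) hu
  · exact h

theorem red_split (H : Setup X π ψ d) {z : S} (hz : π z ≠ 0) (hu : ¬ IsUnit z)
    (hi : ¬ Irreducible z) : ∃ a b, z = a * b ∧ ¬ IsUnit a ∧ ¬ IsUnit b ∧ π a ≠ 0 ∧ π b ≠ 0 ∧
      d z = d a + d b ∧ 0 < d a ∧ 0 < d b := by
  rw [irreducible_iff] at hi
  push Not at hi
  obtain ⟨a, b, rfl, ha, hb⟩ := hi hu
  rw [map_mul] at hz
  have h1 := left_ne_zero_of_mul hz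
  have h2 := right_ne_zero_of_mul hz
  exact ⟨a, b, rfl, ha, hb, h1, h2, H.dmul _ _ (ne0 h1) (ne0 h2), H.deg_pos h1 ha, H.deg_pos h2 hb⟩

theorem art_unit (H : Setup X π ψ d) : ∀ (N : ℕ) (z : S), d z = N → IsUnit (π z) →
    IsArtinian S (S ⧸ Submodule.span S {z}) := by
  intro N
  induction N using Nat.strong_induction_on with
  | _ N ih =>
  intro z hd hz
  by_cases hu : IsUnit z
  · have : Submodule.span S {z} = ⊤ := by
      obtain ⟨v, hv⟩ := hu.exists_left_inv
      exact (Ideal.eq_top_iff_one _).2 (Submodule.mem_span_singleton.2 ⟨v, hv⟩)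
    rw [this]; exact art_top (A := S)
  by_cases hi : Irreducible z
  · have := H.simpleB hi hz
    infer_instance
  obtain ⟨a, b, rfl, ha, hb, h1, h2, h3, h4, h5⟩ := H.red_split hz.ne_zero hu hi
  rw [map_mul] at hz
  apply art_ext _ b
  · refine art_le (L := Submodule.span S {a}) ?_
      (ih (d a) (by omega) a rfl (isUnit_of_mul_isUnit_left hz))
    rw [Submodule.span_singleton_le_iff_mem, mem_colon]
    exact Submodule.mem_span_singleton_self _
  · exact art_le (L := Submodule.span S {b}) le_sup_right
      (ih (d b) (by omega) b rfl (isUnit_of_mul_isUnit_right hz))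

theorem fac_right (H : Setup X π ψ d) (F : Fac π False) : ∀ (N : ℕ) (z : S), d z = N → π z ≠ 0 →
    ¬ IsUnit (π z) → ∃ w c, z = w * c ∧ Typ π False c := by
  intro N
  induction N using Nat.strong_induction_on with
  | _ N ih =>
  intro z hd hz hnu
  have hu : ¬ IsUnit z := fun h => hnu (h.map π)
  by_cases hi : Irreducible z
  · exact ⟨1, z, by simp, hi, hz, by simpa using hnu⟩
  obtain ⟨a, b, rfl, ha, hb, h1, h2, h3, h4, h5⟩ := H.red_split hz hu hi
  by_cases hbu : IsUnit (π b)
  · have hau : ¬ IsUnit (π a) := fun h => hnu (by rw [map_mul]; exact h.mul hbu)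
    obtain ⟨w, c, rfl, hc⟩ := ih (d a) (by omega) a rfl h1 hau
    by_cases hbi : Irreducible b
    · obtain ⟨b', c', -, hc', h⟩ := F c b hc ⟨hbi, h2, by simpa using hbu⟩
      exact ⟨w * b', c', by rw [mul_assoc, h, mul_assoc], hc'⟩
    · obtain ⟨b1, b2, rfl, hb1, hb2, h6, h7, h8, h9, h10⟩ := H.red_split h2 hb hbi
      have hc0 := ne0 hc.2.1
      have hw0 : w ≠ 0 := by rintro rfl; simp at h1
      have e1 := H.dmul w c hw0 hc0
      have e2 := H.dmul c b1 hc0 (ne0 h6)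
      have hcu : ¬ IsUnit (π c) := by simpa using hc.2.2
      obtain ⟨w1, c1, h11, hc1⟩ := ih (d (c * b1)) (by omega) _ rfl
        (by rw [map_mul]; exact mul_ne_zero hc.2.1 h6)
        (fun h => hcu (isUnit_of_mul_isUnit_left (by rwa [map_mul] at h)))
      have hw1 : π w1 ≠ 0 := by
        intro h
        have := congrArg π h11
        rw [map_mul, map_mul, h, zero_mul] at this
        exact (mul_eq_zero.1 this).elim hc.2.1 h6
      have hw1u : ¬ IsUnit w1 := by
        intro h
        obtain ⟨v, hv⟩ := h.exists_left_inv
        have h12 : c1 = (v * c) * b1 := by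
          rw [mul_assoc, h11, ← mul_assoc, hv, one_mul]
        rcases hc1.1.isUnit_or_isUnit h12 with h | h
        · obtain ⟨y, hy⟩ := h.exists_left_inv
          exact hc.1.not_isUnit (unit_of_mul (y * v) c (by rw [mul_assoc, hy])).2
        · exact hb1 h
      have e3 := H.dmul w1 c1 (ne0 hw1) (ne0 hc1.2.1)
      have e4 := H.dmul c1 b2 (ne0 hc1.2.1) (ne0 h7)
      have e5 := H.deg_pos hw1 hw1u
      rw [← h11] at e3
      have hc1u : ¬ IsUnit (π c1) := by simpa using hc1.2.2
      obtain ⟨w2, c2, h13, hc2⟩ := ih (d (c1 * b2)) (by omega) _ rfl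
        (by rw [map_mul]; exact mul_ne_zero hc1.2.1 h7)
        (fun h => hc1u (isUnit_of_mul_isUnit_left (by rwa [map_mul] at h)))
      refine ⟨w * w1 * w2, c2, ?_, hc2⟩
      rw [mul_assoc (w * w1), ← h13, mul_assoc w w1, ← mul_assoc w1 c1, ← h11]
      simp only [mul_assoc]
  · obtain ⟨w, c, rfl, hc⟩ := ih (d b) (by omega) b rfl h2 hbu
    exact ⟨a * w, c, by rw [mul_assoc], hc⟩

end
end Setup

namespace Setup

section
variable {k S T : Type u} [Field k] [Ring S] [Algebra k S] [Ring T] [IsDomain S] [IsDomain T]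
    {X : S} {π : S →ₐ[k] Polynomial k} {ψ : S →+* T} {d : S → ℕ}

theorem span_top_iff (H : Setup X π ψ d) {z : S} (hz : π z ≠ 0) :
    lSpan T (ψ z) = ⊤ ↔ IsUnit z := by
  constructor
  · intro h
    have : ψ 1 ∈ lSpan T (ψ z) := by rw [h]; trivial
    obtain ⟨w, hw⟩ := H.mem_span hz this
    exact (unit_of_mul _ _ hw.symm).2
  · intro h
    obtain ⟨v, hv⟩ := h.exists_left_inv
    exact (Ideal.eq_top_iff_one _).2 (Submodule.mem_span_singleton.2 ⟨ψ v, by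
      rw [smul_eq_mul, ← map_mul, hv, map_one]⟩)

theorem span_unit (w a : S) (hw : IsUnit w) : lSpan T (ψ (w * a)) = lSpan T (ψ a) := by
  obtain ⟨v, hv⟩ := hw.exists_left_inv
  apply le_antisymm
  · rw [Submodule.span_singleton_le_iff_mem]
    exact Submodule.mem_span_singleton.2 ⟨ψ w, by simp⟩
  · rw [Submodule.span_singleton_le_iff_mem]
    exact Submodule.mem_span_singleton.2 ⟨ψ v, by
      rw [smul_eq_mul, ← map_mul, ← mul_assoc, hv, one_mul]⟩

theorem simpleT (H : Setup X π ψ d) {z : S} (hz : π z ≠ 0) :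
    IsSimpleModule T (lQuot T (ψ z)) ↔ Irreducible z := by
  rw [isSimpleModule_iff_isCoatom]
  constructor
  · intro h
    have hnu : ¬ IsUnit z := fun hu => h.1 ((H.span_top_iff hz).2 hu)
    rw [irreducible_iff]
    refine ⟨hnu, ?_⟩
    rintro a b rfl
    rw [map_mul] at hz
    have ha := left_ne_zero_of_mul hz
    have hb := right_ne_zero_of_mul hz
    have hle : lSpan T (ψ (a * b)) ≤ lSpan T (ψ b) := by
      rw [Submodule.span_singleton_le_iff_mem]
      exact Submodule.mem_span_singleton.2 ⟨ψ a, by simp⟩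
    rcases hle.lt_or_eq with h1 | h1
    · exact Or.inr ((H.span_top_iff hb).1 (h.2 _ h1))
    · left
      have : ψ b ∈ lSpan T (ψ (a * b)) := by rw [h1]; exact Submodule.mem_span_singleton_self _
      obtain ⟨w, hw⟩ := H.mem_span (by rwa [map_mul]) this
      rw [← mul_assoc] at hw
      have : w * a = 1 := mul_right_cancel₀ (ne0 hb) (by rw [← hw, one_mul])
      exact (unit_of_mul _ _ this).2
  · intro hi
    refine ⟨fun h => hi.not_isUnit ((H.span_top_iff hz).1 h), ?_⟩
    intro J hJ
    have hzJ : ψ z ∈ J := hJ.le (Submodule.mem_span_singleton_self _)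
    rcases H.pid J with rfl | ⟨a, ha, rfl⟩
    · exact absurd hJ not_lt_bot
    · obtain ⟨w, rfl⟩ := H.mem_span ha hzJ
      rcases hi.isUnit_or_isUnit rfl with h | h
      · exact absurd (span_unit w a h) hJ.ne
      · exact (H.span_top_iff ha).2 h

theorem divX (H : Setup X π ψ d) {z : S} (hu : IsUnit (π z)) (n : ℕ) (s : S) :
    ∃ s' w, s = X ^ n * s' + w * z := by
  induction n generalizing s with
  | zero => exact ⟨s, 0, by simp⟩
  | succ n ih =>
    obtain ⟨s1, w1, h1⟩ := ih s
    obtain ⟨p, hp⟩ := hu.exists_left_inv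
    obtain ⟨w, rfl⟩ := H.surj p
    obtain ⟨v, hv⟩ := H.kerL (s1 - s1 * w * z) (by
      rw [map_sub, map_mul, map_mul, mul_assoc, hp, mul_one, sub_self])
    refine ⟨v, X ^ n * (s1 * w) + w1, ?_⟩
    have : s1 = X * v + s1 * w * z := by rw [← hv]; abel
    calc s = X ^ n * s1 + w1 * z := h1
      _ = X ^ n * (X * v + s1 * w * z) + w1 * z := by rw [← this]
      _ = _ := by rw [pow_succ]; noncomm_ring

theorem cycT (H : Setup X π ψ d) {z : S} (hz : π z ≠ 0) :
    IsUnit (π z) ↔ ∃ v : lQuot T (ψ z), ∀ w, ∃ s : S, w = ψ s • v := by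
  constructor
  · intro hu
    refine ⟨Submodule.Quotient.mk 1, fun w => ?_⟩
    obtain ⟨t, rfl⟩ := Submodule.mkQ_surjective _ w
    obtain ⟨s, n, h⟩ := H.locL t
    obtain ⟨s', w, h1⟩ := H.divX hu n s
    refine ⟨s', ?_⟩
    rw [Submodule.mkQ_apply, ← Submodule.Quotient.mk_smul, Submodule.Quotient.eq]
    obtain ⟨U, hU⟩ := H.unit.pow n
    refine Submodule.mem_span_singleton.2 ⟨(↑U⁻¹ : T) * ψ w, ?_⟩
    have h2 : ψ w * ψ z = ↑U * (t - ψ s') := by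
      rw [hU, mul_sub, h, h1]
      simp
    rw [smul_eq_mul, mul_assoc, h2, Units.inv_mul_cancel_left, smul_eq_mul, mul_one]
  · rintro ⟨v, hv⟩
    obtain ⟨t, rfl⟩ := Submodule.mkQ_surjective _ v
    obtain ⟨s0, n, h⟩ := H.locL t
    obtain ⟨U, hU⟩ := H.unit.pow (n + 1)
    obtain ⟨s, hs⟩ := hv (Submodule.Quotient.mk (↑U⁻¹ : T))
    rw [Submodule.mkQ_apply, ← Submodule.Quotient.mk_smul, Submodule.Quotient.eq] at hs
    obtain ⟨y, hy⟩ := Submodule.mem_span_singleton.1 hs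
    obtain ⟨s', hs', -⟩ := H.normLp n s
    have hs2 := congrArg ψ hs'
    rw [map_mul, map_mul, map_pow] at hs2
    have h1 : (↑U * y) * ψ z = ψ (1 - X * s' * s0) := by
      rw [mul_assoc, ← smul_eq_mul y, hy, mul_sub, Units.mul_inv, smul_eq_mul, hU, map_sub, map_one,
        map_mul, map_mul, ← h, pow_succ', mul_assoc (ψ X), ← mul_assoc _ (ψ s) t, hs2]
      simp only [mul_assoc]
    obtain ⟨y', -, h2⟩ := H.locmem hz h1
    have := congrArg π h2
    rw [map_sub, map_one, map_mul, map_mul, H.piX, zero_mul, zero_mul, sub_zero, map_mul,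
      mul_comm] at this
    exact IsUnit.of_mul_eq_one _ this.symm

theorem typ_iso (H : Setup X π ψ d) {β : Prop} {a p : S} (ha : π a ≠ 0) (hp : Typ π β p)
    (e : lQuot T (ψ a) ≃ₗ[T] lQuot T (ψ p)) : Typ π β a := by
  refine ⟨?_, ha, ?_⟩
  · rw [← H.simpleT ha]
    have := (H.simpleT hp.2.1).2 hp.1
    exact IsSimpleModule.congr e
  · rw [← hp.2.2, H.cycT ha, H.cycT hp.2.1]
    constructor
    · rintro ⟨v, hv⟩
      refine ⟨e v, fun w => ?_⟩
      obtain ⟨s, hs⟩ := hv (e.symm w)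
      exact ⟨s, by rw [← map_smul, ← hs, e.apply_symm_apply]⟩
    · rintro ⟨v, hv⟩
      refine ⟨e.symm v, fun w => ?_⟩
      obtain ⟨s, hs⟩ := hv (e w)
      exact ⟨s, by rw [← map_smul, ← hs, e.symm_apply_apply]⟩

theorem typ_unit {β : Prop} {a p : S} (hp : Typ π β p) (e : ∃ u, IsUnit u ∧ u * p = a) :
    IsUnit (π a) ↔ β := by
  obtain ⟨u, hu, rfl⟩ := e
  rw [map_mul, IsUnit.mul_iff]
  simp [hu.map π, hp.2.2]

theorem typ_not_mem (H : Setup X π ψ d) {β : Prop} {p q : S} (hp : Typ π β p)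
    (hq : Typ π (¬ β) q) : ψ q ∉ lSpan T (ψ p) := by
  intro h
  obtain ⟨w, hw⟩ := H.mem_span hp.2.1 h
  rcases hq.1.isUnit_or_isUnit hw with h1 | h1
  · have h2 := typ_unit hp ⟨w, h1, hw.symm⟩
    have h3 := hq.2.2
    tauto
  · exact hp.1.not_isUnit h1

theorem typ_not_mem' (H : Setup X π ψ d) {β : Prop} {p q : S} (hp : Typ π (¬ β) p)
    (hq : Typ π β q) : ψ q ∉ lSpan T (ψ p) :=
  H.typ_not_mem hp ⟨hq.1, hq.2.1, by rw [hq.2.2, not_not]⟩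

theorem sim_of (H : Setup X π ψ d) {a b x y : S} (ha : π a ≠ 0) (hb : π b ≠ 0)
    (hai : Irreducible a) (hbi : Irreducible b) (h : a * x = y * b) (hx : ψ x ∉ lSpan T (ψ b)) :
    Nonempty (lQuot T (ψ a) ≃ₗ[T] lQuot T (ψ b)) := by
  have h1 := (H.simpleT ha).2 hai
  have h2 := (H.simpleT hb).2 hbi
  have hle : lSpan T (ψ a) ≤ (lSpan T (ψ b)).comap (LinearMap.toSpanSingleton T T (ψ x)) := by
    rw [Submodule.span_singleton_le_iff_mem, Submodule.mem_comap,
      LinearMap.toSpanSingleton_apply, smul_eq_mul, ← map_mul, h, map_mul]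
    exact Submodule.mem_span_singleton.2 ⟨ψ y, rfl⟩
  let f : lQuot T (ψ a) →ₗ[T] lQuot T (ψ b) := Submodule.mapQ _ _ _ hle
  have hf : f ≠ 0 := by
    intro h0
    have : f (Submodule.Quotient.mk 1) = 0 := by rw [h0]; rfl
    rw [Submodule.mapQ_apply, Submodule.Quotient.mk_eq_zero] at this
    simp at this
    exact hx this
  exact ⟨LinearEquiv.ofBijective f (LinearMap.bijective_of_ne_zero hf)⟩

theorem sim (H : Setup X π ψ d) {β : Prop} {p q p' q' : S} (hp : Typ π β p) (hp' : Typ π β p')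
    (hq : Typ π (¬ β) q) (hq' : Typ π (¬ β) q') (h : p * q = q' * p') :
    Nonempty (lQuot T (ψ p') ≃ₗ[T] lQuot T (ψ p)) ∧
      Nonempty (lQuot T (ψ q') ≃ₗ[T] lQuot T (ψ q)) := by
  obtain ⟨e⟩ := H.sim_of hp.2.1 hp'.2.1 hp.1 hp'.1 h (H.typ_not_mem hp' hq)
  exact ⟨⟨e.symm⟩, H.sim_of hq'.2.1 hq.2.1 hq'.1 hq.1 h.symm (H.typ_not_mem' hq hp')⟩

/-- multiplication by `q` gives `T/Tp ≅ Tq/Tpq` -/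
theorem mulEquiv {p q : T} (hq : q ≠ 0) :
    Nonempty (lQuot T p ≃ₗ[T] ↥((lSpan T q).map (lSpan T (p * q)).mkQ)) := by
  let f : T →ₗ[T] lQuot T (p * q) := (lSpan T (p * q)).mkQ.comp (LinearMap.toSpanSingleton T T q)
  have hr : LinearMap.range f = (lSpan T q).map (lSpan T (p * q)).mkQ := by
    rw [LinearMap.range_comp, LinearMap.range_toSpanSingleton]
  have hk : LinearMap.ker f = lSpan T p := by
    ext t
    rw [LinearMap.mem_ker]
    change Submodule.Quotient.mk (t • q) = 0 ↔ _
    rw [Submodule.Quotient.mk_eq_zero, Submodule.mem_span_singleton, Submodule.mem_span_singleton]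
    constructor
    · rintro ⟨a, ha⟩
      refine ⟨a, mul_right_cancel₀ hq ?_⟩
      rw [smul_eq_mul, mul_assoc]; exact ha
    · rintro ⟨a, rfl⟩
      exact ⟨a, by simp [mul_assoc]⟩
  exact ⟨(Submodule.quotEquivOfEq _ _ hk.symm).trans
    (f.quotKerEquivRange.trans (LinearEquiv.ofEq _ _ hr))⟩

theorem mulEquiv' {p q z : T} (hz : z = p * q) (hq : q ≠ 0) :
    Nonempty (lQuot T p ≃ₗ[T] ↥((lSpan T q).map (lSpan T z).mkQ)) := by
  subst hz; exact mulEquiv hq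

/-- the quotient of `T/Tpq` by the image of `Ta` -/
theorem quotEquiv {a z : T} (h : lSpan T z ≤ lSpan T a) :
    Nonempty ((lQuot T z ⧸ (lSpan T a).map (lSpan T z).mkQ) ≃ₗ[T] lQuot T a) :=
  ⟨Submodule.quotientQuotientEquivQuotient _ _ h⟩

theorem span_le_mul (p q : T) : lSpan T (p * q) ≤ lSpan T q := by
  rw [Submodule.span_singleton_le_iff_mem]
  exact Submodule.mem_span_singleton.2 ⟨p, rfl⟩

/-- if there is no swap then `T/Tpq` has only the obvious submodules -/
theorem lattice (H : Setup X π ψ d) {β : Prop} {p q : S} (hp : Typ π β p)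
    (hq : Typ π (¬ β) q)
    (hno : ¬ ∃ q' p', Typ π (¬ β) q' ∧ Typ π β p' ∧ p * q = q' * p')
    (A : Submodule T (lQuot T (ψ (p * q)))) :
    A = ⊥ ∨ A = (lSpan T (ψ q)).map (lSpan T (ψ (p * q))).mkQ ∨ A = ⊤ := by
  set Z := lSpan T (ψ (p * q)) with hZ
  set N := (lSpan T (ψ q)).map Z.mkQ with hN
  have hle : Z ≤ lSpan T (ψ q) := by rw [hZ, map_mul]; exact span_le_mul _ _
  have hψq : ψ q ≠ 0 := fun h => ne0 hq.2.1 (H.inj (by rw [h, map_zero]))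
  obtain ⟨eN⟩ : Nonempty (lQuot T (ψ p) ≃ₗ[T] N) := by
    rw [hN, hZ, map_mul]; exact mulEquiv hψq
  obtain ⟨eQ⟩ := quotEquiv hle
  have hs1 := (H.simpleT hp.2.1).2 hp.1
  have hs2 := (H.simpleT hq.2.1).2 hq.1
  have hsN : IsAtom N := by
    rw [← isSimpleModule_iff_isAtom]; exact IsSimpleModule.congr eN.symm
  have hcN : IsCoatom N := by
    rw [← isSimpleModule_iff_isCoatom]; exact IsSimpleModule.congr eQ
  by_contra hcon
  push Not at hcon
  obtain ⟨hA0, hAN, hAT⟩ := hcon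
  have hnle : ¬ A ≤ N := fun h => (hsN.le_iff.1 h).elim hA0 hAN
  have hnge : ¬ N ≤ A := fun h => (hcN.le_iff.1 h).elim hAT hAN
  have hc : IsCompl N A := by
    constructor
    · rw [disjoint_iff]
      refine (hsN.le_iff.1 inf_le_left).resolve_right fun h => hnge (inf_eq_left.1 h)
    · rw [codisjoint_iff]
      refine (hcN.le_iff.1 le_sup_left).resolve_right fun h => hnle (sup_eq_left.1 h)
  have hpq0 : π (p * q) ≠ 0 := by rw [map_mul]; exact mul_ne_zero hp.2.1 hq.2.1
  have hZJ : Z ≤ A.comap Z.mkQ := by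
    intro x hx
    rw [Submodule.mem_comap, Submodule.mkQ_apply, (Submodule.Quotient.mk_eq_zero Z).2 hx]
    exact A.zero_mem
  have hzJ : ψ (p * q) ∈ A.comap Z.mkQ := hZJ (Submodule.mem_span_singleton_self _)
  rcases H.pid (A.comap Z.mkQ) with h | ⟨a, ha, hJ⟩
  · rw [h, Submodule.mem_bot] at hzJ
    exact ne0 hpq0 (H.inj (by rw [hzJ, map_zero]))
  have hAmap : A = (lSpan T (ψ a)).map Z.mkQ := by
    change A = (Submodule.span T {ψ a}).map Z.mkQ
    rw [← hJ, Submodule.map_comap_eq, Submodule.range_mkQ, top_inf_eq]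
  rw [hJ] at hZJ hzJ
  obtain ⟨w, hw⟩ := H.mem_span ha hzJ
  have hw0 : π w ≠ 0 := by
    rw [hw, map_mul] at hpq0; exact left_ne_zero_of_mul hpq0
  apply hno
  have hψa : ψ a ≠ 0 := fun h => ne0 ha (H.inj (by rw [h, map_zero]))
  obtain ⟨eA⟩ : Nonempty (lQuot T (ψ w) ≃ₗ[T] A) := by
    rw [hAmap]; exact mulEquiv' (by rw [hw, map_mul]) hψa
  obtain ⟨eB⟩ : Nonempty ((lQuot T (ψ (p * q)) ⧸ A) ≃ₗ[T] lQuot T (ψ a)) := by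
    rw [hAmap]; exact quotEquiv hZJ
  refine ⟨w, a, ?_, ?_, hw⟩
  · exact H.typ_iso hw0 hq (eA.trans ((Submodule.quotientEquivOfIsCompl N A hc).symm.trans eQ))
  · exact H.typ_iso ha hp
      (eB.symm.trans ((Submodule.quotientEquivOfIsCompl A N hc.symm).trans eN.symm))

theorem uelt (H : Setup X π ψ d) {β : Prop} {p q : S} (hp : Typ π β p)
    (hq : Typ π (¬ β) q)
    (hno : ¬ ∃ q' p', Typ π (¬ β) q' ∧ Typ π β p' ∧ p * q = q' * p')
    {w z : S} (h : p * q = w * z) (hw : ¬ IsUnit w) : ∃ v, q = v * z := by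
  have hpq0 : π (p * q) ≠ 0 := by rw [map_mul]; exact mul_ne_zero hp.2.1 hq.2.1
  have hz0 : π z ≠ 0 := by
    rw [h, map_mul] at hpq0; exact right_ne_zero_of_mul hpq0
  have hZ : lSpan T (ψ (p * q)) ≤ lSpan T (ψ z) := by rw [h, map_mul]; exact span_le_mul _ _
  have hcm : ((lSpan T (ψ z)).map (lSpan T (ψ (p * q))).mkQ).comap (lSpan T (ψ (p * q))).mkQ
      = lSpan T (ψ z) := by
    rw [Submodule.comap_map_eq, Submodule.ker_mkQ, sup_eq_left]; exact hZ
  apply H.mem_span hz0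
  change ψ q ∈ lSpan T (ψ z)
  rw [← hcm, Submodule.mem_comap]
  rcases H.lattice hp hq hno ((lSpan T (ψ z)).map (lSpan T (ψ (p * q))).mkQ) with h1 | h1 | h1
  · exfalso
    have h2 : ψ z ∈ lSpan T (ψ (p * q)) := by
      have : ψ z ∈ lSpan T (ψ z) := Submodule.mem_span_singleton_self _
      rw [← hcm, h1, Submodule.mem_comap, Submodule.mem_bot] at this
      exact (Submodule.Quotient.mk_eq_zero _).1 this
    obtain ⟨v, hv⟩ := H.mem_span hpq0 h2
    rw [h, ← mul_assoc] at hv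
    exact hw (unit_of_mul v w (mul_right_cancel₀ (ne0 hz0) (by rw [← hv, one_mul]))).2
  · rw [h1]; exact Submodule.mem_map_of_mem (Submodule.mem_span_singleton_self _)
  · rw [h1]; trivial

theorem uniserial_iff (H : Setup X π ψ d) (β : Prop) :
    (¬ ∃ (M : Type u) (_ : AddCommGroup M) (_ : Module T M) (N : Submodule T M) (p q : S),
      (∀ A B : Submodule T M, A ≤ B ∨ B ≤ A) ∧ N ≠ ⊥ ∧ N ≠ ⊤ ∧
      IsSimpleModule T N ∧ IsSimpleModule T (M ⧸ N) ∧
      Typ π β p ∧ Nonempty (↥N ≃ₗ[T] lQuot T (ψ p)) ∧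
      Typ π (¬ β) q ∧ Nonempty ((M ⧸ N) ≃ₗ[T] lQuot T (ψ q))) ↔ Fac π β := by
  constructor
  · intro h p q hp hq
    by_contra hno
    apply h
    set Z := lSpan T (ψ (p * q)) with hZ
    have hle : Z ≤ lSpan T (ψ q) := by rw [hZ, map_mul]; exact span_le_mul _ _
    have hψq : ψ q ≠ 0 := fun h => ne0 hq.2.1 (H.inj (by rw [h, map_zero]))
    obtain ⟨eN⟩ : Nonempty (lQuot T (ψ p) ≃ₗ[T] (lSpan T (ψ q)).map Z.mkQ) := by
      rw [hZ, map_mul]; exact mulEquiv hψq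
    obtain ⟨eQ⟩ := quotEquiv hle
    have hs1 := (H.simpleT hp.2.1).2 hp.1
    have hs2 := (H.simpleT hq.2.1).2 hq.1
    have hi1 : IsSimpleModule T ((lSpan T (ψ q)).map Z.mkQ) := IsSimpleModule.congr eN.symm
    have hi2 : IsSimpleModule T (lQuot T (ψ (p * q)) ⧸ ((lSpan T (ψ q)).map Z.mkQ)) :=
      IsSimpleModule.congr eQ
    refine ⟨lQuot T (ψ (p * q)), inferInstance, inferInstance, (lSpan T (ψ q)).map Z.mkQ, p, q,
      ?_, ?_, ?_, hi1, hi2, hp, ⟨eN.symm⟩, hq, ⟨eQ⟩⟩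
    · intro A B
      rcases H.lattice hp hq hno A with rfl | rfl | rfl
      · exact Or.inl bot_le
      · rcases H.lattice hp hq hno B with rfl | rfl | rfl
        · exact Or.inr bot_le
        · exact Or.inl le_rfl
        · exact Or.inl le_top
      · exact Or.inr le_top
    · exact (isSimpleModule_iff_isAtom.1 hi1).1
    · exact (isSimpleModule_iff_isCoatom.1 hi2).1
  · rintro F ⟨M, _, _, N, p, q, huni, -, -, hs1, hs2, hp, ⟨eN⟩, hq, ⟨eQ⟩⟩
    obtain ⟨m, hm⟩ := Submodule.mkQ_surjective N (eQ.symm (Submodule.Quotient.mk 1))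
    let f : T →ₗ[T] M := LinearMap.toSpanSingleton T M m
    have hfN : ∀ t, f t ∈ N ↔ t ∈ lSpan T (ψ q) := by
      intro t
      rw [← Submodule.Quotient.mk_eq_zero N]
      change N.mkQ (t • m) = 0 ↔ _
      rw [map_smul, hm, ← map_smul, LinearEquiv.map_eq_zero_iff, ← Submodule.Quotient.mk_smul,
        Submodule.Quotient.mk_eq_zero]
      simp
    have hcN : IsCoatom N := isSimpleModule_iff_isCoatom.1 hs2
    have hm1 : m ∉ N := by
      intro h
      have : (1 : T) ∈ lSpan T (ψ q) := (hfN 1).1 (by simpa [f] using h)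
      exact hq.1.not_isUnit ((H.span_top_iff hq.2.1).1 ((Ideal.eq_top_iff_one _).2 this))
    have hfm : ∀ t, f t = t • m := fun t => rfl
    have htop : LinearMap.range f = ⊤ := by
      have hmr : m ∈ LinearMap.range f := ⟨1, by simp [hfm]⟩
      rcases huni N (LinearMap.range f) with h | h
      · rcases hcN.le_iff.1 h with h1 | h1
        · exact h1
        · exact absurd (h1 ▸ hmr) hm1
      · exact absurd (h hmr) hm1
    have hkle : LinearMap.ker f ≤ lSpan T (ψ q) := by
      intro t ht
      rw [← hfN, LinearMap.mem_ker.1 ht]; exact N.zero_mem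
    -- `ker f` is nonzero
    have hψq : ψ q ≠ 0 := fun h => ne0 hq.2.1 (H.inj (by rw [h, map_zero]))
    have hψp : ψ p ≠ 0 := fun h => ne0 hp.2.1 (H.inj (by rw [h, map_zero]))
    have hkne : LinearMap.ker f ≠ ⊥ := by
      intro hk
      have hinj := LinearMap.ker_eq_bot.1 hk
      obtain ⟨t0, ht0⟩ : (eN.symm (Submodule.Quotient.mk 1) : M) ∈ LinearMap.range f := by
        rw [htop]; trivial
      have h1 : f (ψ p * t0) = 0 := by
        rw [← smul_eq_mul, map_smul, ht0, ← Submodule.coe_smul, ← map_smul,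
          ← Submodule.Quotient.mk_smul, (Submodule.Quotient.mk_eq_zero _).2, map_zero,
          Submodule.coe_zero]
        exact Submodule.mem_span_singleton.2 ⟨1, by simp⟩
      have h2 : ψ p * t0 = 0 := hinj (by rw [h1, map_zero])
      have h3 : t0 = 0 := (mul_eq_zero.1 h2).resolve_left hψp
      rw [h3, map_zero] at ht0
      have h4 : eN.symm (Submodule.Quotient.mk 1) = 0 := Subtype.ext ht0.symm
      rw [LinearEquiv.map_eq_zero_iff, Submodule.Quotient.mk_eq_zero] at h4
      exact hp.1.not_isUnit ((H.span_top_iff hp.2.1).1 ((Ideal.eq_top_iff_one _).2 h4))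
    rcases H.pid (LinearMap.ker f) with h | ⟨z, hz, hker⟩
    · exact hkne h
    have hzq : ψ z ∈ lSpan T (ψ q) := hkle (by rw [hker]; exact Submodule.mem_span_singleton_self _)
    obtain ⟨p1, hp1⟩ := H.mem_span hq.2.1 hzq
    have hp10 : π p1 ≠ 0 := by
      rw [hp1, map_mul] at hz; exact left_ne_zero_of_mul hz
    have hfq : f (ψ q) ∈ N := (hfN _).2 (Submodule.mem_span_singleton_self _)
    let g : T →ₗ[T] N := LinearMap.toSpanSingleton T N ⟨f (ψ q), hfq⟩
    have hgk : LinearMap.ker g = lSpan T (ψ p1) := by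
      ext t
      have h1 : t ∈ LinearMap.ker g ↔ t * ψ q ∈ LinearMap.ker f := by
        rw [LinearMap.mem_ker, LinearMap.mem_ker, ← smul_eq_mul, map_smul]
        exact Subtype.ext_iff
      rw [h1, hker, Submodule.mem_span_singleton, Submodule.mem_span_singleton]
      simp only [hp1, map_mul, smul_eq_mul, ← mul_assoc]
      exact exists_congr fun a => ⟨fun h => mul_right_cancel₀ hψq h, fun h => by rw [h]⟩
    have hgs : Function.Surjective g := by
      rintro ⟨n, hn⟩
      obtain ⟨t, rfl⟩ : n ∈ LinearMap.range f := by rw [htop]; trivial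
      obtain ⟨a, ha⟩ := Submodule.mem_span_singleton.1 ((hfN t).1 hn)
      exact ⟨a, Subtype.ext (by change a • f (ψ q) = f t; rw [← ha, map_smul])⟩
    have e1 : lQuot T (ψ p1) ≃ₗ[T] N :=
      (Submodule.quotEquivOfEq _ _ hgk.symm).trans (LinearMap.quotKerEquivOfSurjective g hgs)
    have ht1 : Typ π β p1 := H.typ_iso hp10 hp (e1.trans eN)
    obtain ⟨q', p', hq', hp', hsw⟩ := F p1 q ht1 hq
    have hkp : LinearMap.ker f ≤ lSpan T (ψ p') := by
      rw [hker, hp1, hsw, map_mul]; exact span_le_mul _ _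
    rcases huni ((lSpan T (ψ p')).map f) N with h | h
    · apply H.typ_not_mem' hq hp'
      rw [← hfN]
      exact h (Submodule.mem_map_of_mem (Submodule.mem_span_singleton_self _))
    · apply H.typ_not_mem hp' hq
      obtain ⟨y, hy, hyq⟩ := h hfq
      have : ψ q - y ∈ LinearMap.ker f := by rw [LinearMap.mem_ker, map_sub, hyq, sub_self]
      have := Submodule.add_mem _ (hkp this) hy
      simpa using this

end
end Setup

/-- every module embeds into an injective module -/
theorem exists_embed (A : Type u) [Ring A] (M : Type u) [AddCommGroup M] [Module A M] :
    ∃ (I : Type u) (_ : AddCommGroup I) (_ : Module A I) (j : M →ₗ[A] I),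
      Module.Injective A I ∧ Function.Injective j := by
  let Mc : ModuleCat.{u} A := ModuleCat.of A M
  let J := CategoryTheory.Injective.under Mc
  refine ⟨J, inferInstance, inferInstance, (CategoryTheory.Injective.ι Mc).hom, ?_, ?_⟩
  · have h : CategoryTheory.Injective J := inferInstance
    exact Module.injective_module_of_injective_object A J
  · have h : CategoryTheory.Mono (CategoryTheory.Injective.ι Mc) := inferInstance
    exact (ModuleCat.mono_iff_injective _).1 h

theorem exists_hull {A : Type u} [Ring A] {V M : Type u} [AddCommGroup V] [Module A V]
    [AddCommGroup M] [Module A M] (f : V →ₗ[A] M) (hf : Function.Injective f)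
    (he : IsEssentialSubmodule (LinearMap.range f)) :
    ∃ (E : Type u) (_ : AddCommGroup E) (_ : Module A E) (g : M →ₗ[A] E),
      Function.Injective g ∧ IsInjectiveHullVia A (g.comp f) := by
  obtain ⟨I, _, _, j, hI, hj⟩ := exists_embed A M
  let U : Submodule A I := LinearMap.range (j.comp f)
  let P : Submodule A I → Prop := fun W => ∀ B ≤ W, B ≠ ⊥ → B ⊓ U ≠ ⊥
  have hP0 : P (LinearMap.range j) := by
    intro B hB hB0 hBU
    have h1 : B.comap j ≠ ⊥ := by
      intro h
      apply hB0
      rw [← inf_eq_right.2 hB, ← Submodule.map_comap_eq, h, Submodule.map_bot]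
    apply he _ h1
    rw [eq_bot_iff]
    rintro x ⟨hx, v, rfl⟩
    have : j (f v) ∈ B ⊓ U := ⟨hx, v, rfl⟩
    rw [hBU, Submodule.mem_bot] at this
    rw [Submodule.mem_bot]
    exact hj (by rw [this, map_zero])
  obtain ⟨W, hjW, hW⟩ := zorn_le_nonempty₀ {W | P W} (by
    intro c hc hch y hy
    refine ⟨sSup c, ?_, fun z hz => le_sSup hz⟩
    intro B hB hB0
    obtain ⟨b, hb, hb0⟩ := (Submodule.ne_bot_iff _).1 hB0
    obtain ⟨Z, hZ, hbZ⟩ := (Submodule.mem_sSup_of_directed ⟨y, hy⟩ hch.directedOn).1 (hB hb)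
    have h1 := hc hZ (Submodule.span A {b}) (by simpa using hbZ) (by simpa using hb0)
    intro h2
    apply h1
    rw [eq_bot_iff, ← h2]
    exact inf_le_inf_right _ (by simpa using hb)) _ hP0
  obtain ⟨K, -, hK⟩ := zorn_le_nonempty₀ {K : Submodule A I | K ⊓ W = ⊥} (by
    intro c hc hch y hy
    refine ⟨sSup c, ?_, fun z hz => le_sSup hz⟩
    change sSup c ⊓ W = ⊥
    rw [eq_bot_iff]
    rintro x ⟨hx, hxW⟩
    obtain ⟨Z, hZ, hbZ⟩ := (Submodule.mem_sSup_of_directed ⟨y, hy⟩ hch.directedOn).1 hx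
    have : x ∈ Z ⊓ W := ⟨hbZ, hxW⟩
    rw [show Z ⊓ W = ⊥ from hc hZ] at this
    exact this) ⊥ (by simp)
  have hKW : K ⊓ W = ⊥ := hK.prop
  have hKmax : ∀ K', K ≤ K' → K' ⊓ W = ⊥ → K' = K := fun K' h h' => (hK.eq_of_le h' h).symm
  obtain ⟨g, hg⟩ := hI.out (K.mkQ.comp W.subtype) (by
    rw [← LinearMap.ker_eq_bot, eq_bot_iff]
    rintro ⟨x, hx⟩ h
    have h1 : x ∈ K := (Submodule.Quotient.mk_eq_zero K).1 h
    have : x ∈ K ⊓ W := ⟨h1, hx⟩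
    rw [hKW, Submodule.mem_bot] at this
    simpa using this) W.subtype
  have hg' : ∀ x ∈ W, g (K.mkQ x) = x := fun x hx => hg ⟨x, hx⟩
  have hgi : ∀ x, g (K.mkQ x) = 0 → x ∈ K := by
    have : (LinearMap.ker g).comap K.mkQ = K := by
      apply hKmax
      · intro x hx
        rw [Submodule.mem_comap, Submodule.mkQ_apply, (Submodule.Quotient.mk_eq_zero K).2 hx]
        exact Submodule.zero_mem _
      · rw [eq_bot_iff]
        rintro x ⟨h1, h2⟩
        have h3 : g (K.mkQ x) = 0 := h1
        rwa [hg' x h2] at h3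
    intro x hx
    rw [← this]; exact hx
  have hrg : LinearMap.range g ≤ W := by
    have hWr : W ≤ LinearMap.range g := fun x hx => ⟨K.mkQ x, hg' x hx⟩
    refine (hW.eq_of_le ?_ hWr).ge
    intro B hB hB0
    have h1 : B ⊓ W ≠ ⊥ := by
      intro h0
      apply hB0
      have h2 : (B.comap g).comap K.mkQ = K := by
        apply hKmax
        · intro x hx
          rw [Submodule.mem_comap, Submodule.mkQ_apply, (Submodule.Quotient.mk_eq_zero K).2 hx]
          exact Submodule.zero_mem _
        · rw [eq_bot_iff]
          rintro x ⟨h1, h2⟩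
          have h3 : g (K.mkQ x) ∈ B := h1
          rw [hg' x h2] at h3
          rw [← h0]; exact ⟨h3, h2⟩
      rw [eq_bot_iff]
      intro b hb
      obtain ⟨y, rfl⟩ := hB hb
      obtain ⟨x, rfl⟩ := K.mkQ_surjective y
      have h4 : x ∈ K := by rw [← h2]; exact hb
      rw [Submodule.mkQ_apply, (Submodule.Quotient.mk_eq_zero K).2 h4, map_zero]
      exact Submodule.zero_mem _
    have h2 := hW.prop (B ⊓ W) inf_le_right h1
    intro h3
    apply h2
    rw [eq_bot_iff, ← h3]
    exact inf_le_inf_right _ inf_le_left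
  let r : I →ₗ[A] W := (g.comp K.mkQ).codRestrict W fun x => hrg ⟨_, rfl⟩
  refine ⟨W, inferInstance, inferInstance, j.codRestrict W fun x => hjW ⟨x, rfl⟩, ?_, ?_, ?_, ?_⟩
  · intro x y h
    exact hj (congrArg Subtype.val h)
  · constructor
    intro Y Z _ _ _ _ a ha b
    obtain ⟨h, hh⟩ := hI.out a ha (W.subtype.comp b)
    refine ⟨r.comp h, fun x => Subtype.ext ?_⟩
    change g (K.mkQ (h (a x))) = _
    rw [hh]; exact hg' _ (b x).2
  · intro x y h
    exact hf (hj (congrArg Subtype.val h))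
  · intro B hB
    have h1 := hW.prop (B.map W.subtype) (Submodule.map_subtype_le _ _) (by
      intro h; apply hB
      rw [eq_bot_iff]
      intro b hb
      have h2 : W.subtype b ∈ B.map W.subtype := Submodule.mem_map_of_mem hb
      rw [h, Submodule.mem_bot] at h2
      exact Subtype.ext h2)
    obtain ⟨x, ⟨hx, v, hv⟩, hx0⟩ := (Submodule.ne_bot_iff _).1 h1
    obtain ⟨b, hb, rfl⟩ := hx
    rw [Submodule.ne_bot_iff]
    refine ⟨b, ⟨hb, v, Subtype.ext hv⟩, fun h => hx0 (by rw [h, map_zero])⟩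

namespace Setup
section
variable {k S T : Type u} [Field k] [Ring S] [Algebra k S] [Ring T] [IsDomain S] [IsDomain T]
    {X : S} {π : S →ₐ[k] Polynomial k} {ψ : S →+* T} {d : S → ℕ}

/-- ideals properly containing `Spq` when there is no swap -/
theorem above (H : Setup X π ψ d) {β : Prop} {p q : S} (hp : Typ π β p)
    (hq : Typ π (¬ β) q)
    (hno : ¬ ∃ q' p', Typ π (¬ β) q' ∧ Typ π β p' ∧ p * q = q' * p')
    (L : Submodule S S) (hL : Submodule.span S {p * q} < L) : ∃ n, X ^ n * q ∈ L := by
  have hpq0 : π (p * q) ≠ 0 := by rw [map_mul]; exact mul_ne_zero hp.2.1 hq.2.1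
  have hpqL : p * q ∈ L := hL.le (Submodule.mem_span_singleton_self _)
  obtain ⟨z, n, hz, h1, h2⟩ := H.struct L (by
    rintro rfl; exact ne0 hpq0 ((Submodule.mem_bot _).1 hpqL))
  obtain ⟨w, hw⟩ := h1 _ hpqL
  have hwu : ¬ IsUnit w := by
    intro hu
    apply hL.not_ge
    intro s hs
    obtain ⟨t, rfl⟩ := h1 s hs
    have h3 : z ∈ Submodule.span S {w * z} := span_unit_mul hu
    rw [hw]
    exact Submodule.smul_mem _ t h3
  obtain ⟨v, hv⟩ := H.uelt hp hq hno hw hwu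
  obtain ⟨v', hv', -⟩ := H.normLp n v
  refine ⟨n, ?_⟩
  rw [hv, ← mul_assoc, hv', mul_assoc]
  exact Submodule.smul_mem _ v' h2

theorem not_mem_pq (H : Setup X π ψ d) {p q : S} (hp : ¬ IsUnit p) (hp0 : π p ≠ 0) (hq : q ≠ 0)
    (n : ℕ) : X ^ n * q ∉ Submodule.span S {p * q} := by
  intro h
  obtain ⟨t, ht⟩ := Submodule.mem_span_singleton.1 h
  rw [smul_eq_mul, ← mul_assoc] at ht
  have h1 : t * p = X ^ n := mul_right_cancel₀ hq ht
  have h2 : ψ t * ψ p = ψ X ^ n := by rw [← map_mul, h1, map_pow]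
  apply hp
  rw [← H.span_top_iff hp0]
  obtain ⟨v, hv⟩ := (H.unit.pow n).exists_left_inv
  refine (Ideal.eq_top_iff_one _).2 (Submodule.mem_span_singleton.2 ⟨v * ψ t, ?_⟩)
  rw [smul_eq_mul, mul_assoc, h2, hv]

theorem diamond_fac (H : Setup X π ψ d) (hD : HasDiamond S) : Fac π True := by
  intro p q hp hq
  by_contra hno
  have hq0 : q ≠ 0 := ne0 hq.2.1
  obtain ⟨e⟩ : Nonempty (lQuot S p ≃ₗ[S] _) := mulEquiv (p := p) hq0
  have hs : IsSimpleModule S (lQuot S p) := H.simpleB hp.1 (hp.2.2.2 trivial)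
  let f : lQuot S p →ₗ[S] lQuot S (p * q) := (Submodule.subtype _).comp e.toLinearMap
  have hfr : LinearMap.range f = (lSpan S q).map (lSpan S (p * q)).mkQ := by
    rw [LinearMap.range_comp, LinearEquiv.range, Submodule.map_top, Submodule.range_subtype]
  obtain ⟨E, _, _, g, hg, hhull⟩ := exists_hull f (by
    intro x y h; exact e.injective (Subtype.ext h)) (by
    intro W hW h0
    have hlt : lSpan S (p * q) < W.comap (lSpan S (p * q)).mkQ := by
      refine lt_of_le_of_ne ?_ ?_
      · intro x hx
        rw [Submodule.mem_comap, Submodule.mkQ_apply, (Submodule.Quotient.mk_eq_zero _).2 hx]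
        exact Submodule.zero_mem _
      · intro h; apply hW
        rw [eq_bot_iff]
        intro x hx
        obtain ⟨y, rfl⟩ := Submodule.mkQ_surjective _ x
        have h1 : y ∈ W.comap (lSpan S (p * q)).mkQ := hx
        rw [← h] at h1
        exact (Submodule.Quotient.mk_eq_zero _).2 h1
    obtain ⟨n, hn⟩ := H.above hp hq hno _ hlt
    apply H.not_mem_pq hp.1.not_isUnit hp.2.1 hq0 n
    rw [← Submodule.Quotient.mk_eq_zero, ← Submodule.mem_bot (R := S), ← h0]
    refine ⟨hn, ?_⟩
    rw [SetLike.mem_coe, hfr]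
    exact Submodule.mem_map_of_mem (Submodule.mem_span_singleton.2 ⟨X ^ n, rfl⟩))
  have hart := hD _ E (g.comp f) hs hhull (LinearMap.range g) (by
    rw [LinearMap.range_eq_map]
    exact Submodule.FG.map _ (Module.Finite.fg_top))
  have ha2 : IsArtinian S (lQuot S (p * q)) :=
    isArtinian_of_injective (g.rangeRestrict) (by
      intro x y h; exact hg (congrArg Subtype.val h))
  refine H.nonart (z := p * q) ?_ ?_ ha2
  · rw [map_mul]; exact mul_ne_zero hp.2.1 hq.2.1
  · rw [map_mul, IsUnit.mul_iff, hq.2.2]; tauto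

end
end Setup

theorem fac_op {k S : Type u} [Field k] [Ring S] [Algebra k S] (π : S →ₐ[k] Polynomial k)
    {β γ : Prop} (h : γ ↔ ¬ β) :
    Fac (π.fromOpposite (fun _ _ => mul_comm _ _)) γ ↔ Fac π β := by
  obtain rfl : γ = ¬ β := propext h
  have hT : ∀ (δ : Prop) (z : S),
      Typ (π.fromOpposite (fun _ _ => mul_comm _ _)) δ (op z) ↔ Typ π δ z := by
    intro δ z
    unfold Typ
    have h1 : Irreducible (op z) ↔ Irreducible z := by
      constructor
      · intro h
        rw [irreducible_iff]
        refine ⟨fun hu => h.not_isUnit (by simpa using hu), ?_⟩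
        rintro a b rfl
        have := h.isUnit_or_isUnit (a := op b) (b := op a) (by simp)
        simpa [or_comm] using this
      · intro h
        rw [irreducible_iff]
        refine ⟨fun hu => h.not_isUnit (by simpa using hu), ?_⟩
        intro a b hab
        have := h.isUnit_or_isUnit (a := unop b) (b := unop a) (op_injective (by simpa using hab))
        simpa [or_comm] using this
    rw [h1]; rfl
  have hnn : (¬ ¬ β) = β := propext not_not
  constructor
  · intro F p q hp hq
    obtain ⟨p', q', hp', hq', hs⟩ := F (op q) (op p) ((hT _ _).2 hq) ((hT _ _).2 (by rwa [hnn]))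
    refine ⟨unop q', unop p', (hT _ _).1 hq', ?_, ?_⟩
    · rw [hnn] at hp'; exact (hT _ _).1 hp'
    · exact op_injective (by simpa using hs)
  · intro F p q hp hq
    rw [hnn] at hq
    obtain ⟨q', p', hq', hp', hs⟩ := F (unop q) (unop p) ((hT _ _).1 hq) ((hT _ _).1 hp)
    refine ⟨op p', op q', ?_, (hT _ _).2 hq', ?_⟩
    · rw [hnn]; exact (hT _ _).2 hp'
    · exact unop_injective (by simpa using hs)

namespace Setup
section
variable {k S T : Type u} [Field k] [Ring S] [Algebra k S] [Ring T] [IsDomain S] [IsDomain T]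
    {X : S} {π : S →ₐ[k] Polynomial k} {ψ : S →+* T} {d : S → ℕ}

/-- `{s | X^n s ∈ L}` -/
def Kn (H : Setup X π ψ d) (L : Submodule S S) (n : ℕ) : Submodule S S where
  carrier := {s | X ^ n * s ∈ L}
  zero_mem' := by simp
  add_mem' := by
    intro a b ha hb
    change X ^ n * (a + b) ∈ L
    rw [mul_add]; exact L.add_mem ha hb
  smul_mem' := by
    intro c s hs
    change X ^ n * (c * s) ∈ L
    obtain ⟨c', h, -⟩ := H.normLp n c
    rw [← mul_assoc, h, mul_assoc]
    exact L.smul_mem c' hs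

/-- `{s | X s ∈ L, f^m s ∈ L}` -/
def Jm (H : Setup X π ψ d) (L : Submodule S S) (f : S) : Submodule S S where
  carrier := {s | X * s ∈ L ∧ f * s ∈ L}
  zero_mem' := by simp
  add_mem' := by
    rintro a b ⟨ha, ha'⟩ ⟨hb, hb'⟩
    refine ⟨?_, ?_⟩
    · rw [mul_add]; exact L.add_mem ha hb
    · rw [mul_add]; exact L.add_mem ha' hb'
  smul_mem' := by
    rintro c s ⟨hs, hs'⟩
    refine ⟨?_, ?_⟩
    · obtain ⟨c', h⟩ := H.normL c
      rw [smul_eq_mul, ← mul_assoc, h, mul_assoc]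
      exact L.smul_mem c' hs
    · obtain ⟨t, ht⟩ := H.kerR (f * c - c * f) (by
        rw [map_sub, map_mul, map_mul, mul_comm, sub_self])
      have : f * (c • s) = c * (f * s) + t * (X * s) := by
        rw [← mul_assoc t, ← ht, smul_eq_mul]; noncomm_ring
      rw [this]
      exact L.add_mem (L.smul_mem _ hs') (L.smul_mem _ hs)

theorem core1 (H : Setup X π ψ d) (F : Fac π True) (L : Submodule S S) {v0 : S} (h0 : v0 ∉ L)
    (hv : ∀ s, s ∉ L → ∃ t, v0 - t * s ∈ L) (hX : ∀ s, X * s ∈ L → s ∈ L) :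
    IsArtinian S (S ⧸ L) := by
  have hXn : ∀ n s, X ^ n * s ∈ L → s ∈ L := by
    intro n
    induction n with
    | zero => intro s h; simpa using h
    | succ n ih =>
      intro s h
      apply ih
      apply hX
      rwa [← mul_assoc, ← pow_succ']
  have hLb : L ≠ ⊥ := by
    rintro rfl
    obtain ⟨t, ht⟩ := hv (X * v0) fun h => h0 (hX _ h)
    rw [Submodule.mem_bot, sub_eq_zero, ← mul_assoc] at ht
    have hv0 : v0 ≠ 0 := fun h => h0 (by simp [h])
    have h1 : 1 = t * X := mul_right_cancel₀ hv0 (by rw [← ht, one_mul])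
    have h2 := congrArg π h1
    rw [map_mul, H.piX, mul_zero, map_one] at h2
    exact one_ne_zero h2
  obtain ⟨z, n, hz, hz1, hz2⟩ := H.struct L hLb
  have hzL : z ∈ L := hXn n z hz2
  obtain rfl : L = Submodule.span S {z} := by
    apply le_antisymm
    · intro s hs
      obtain ⟨w, rfl⟩ := hz1 s hs
      exact Submodule.mem_span_singleton.2 ⟨w, rfl⟩
    · simpa using hzL
  by_cases hu : IsUnit (π z)
  · exact H.art_unit _ z rfl hu
  exfalso
  obtain ⟨w, c, hwc, hc⟩ := H.toOp.fac_right ((fac_op π (by simp)).2 F) _ (op z) rfl hz hu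
  obtain ⟨w, rfl⟩ := op_surjective w
  obtain ⟨c, rfl⟩ := op_surjective c
  have hcw : z = c * w := op_injective (by simpa using hwc)
  have hci : ¬ IsUnit c := fun h => hc.1.not_isUnit (by simpa using h)
  have hc0 : π c ≠ 0 := hc.2.1
  have hcu : ¬ IsUnit (π c) := hc.2.2.1
  have hcI : ∀ a b, c = a * b → IsUnit a ∨ IsUnit b := by
    rintro a b rfl
    have := hc.1.isUnit_or_isUnit (a := op b) (b := op a) (by simp)
    simpa [or_comm] using this
  have hw0 : w ≠ 0 := by
    rintro rfl; rw [hcw, mul_zero, map_zero] at hz; exact hz rfl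
  have hmem : ∀ s, s * w ∈ Submodule.span S {z} ↔ s ∈ Submodule.span S {c} := by
    intro s
    rw [Submodule.mem_span_singleton, Submodule.mem_span_singleton, hcw]
    simp only [smul_eq_mul, ← mul_assoc]
    exact exists_congr fun a => ⟨fun h => mul_right_cancel₀ hw0 h, fun h => by rw [h]⟩
  have h1c : (1 : S) ∉ Submodule.span S {c} := by
    intro h
    obtain ⟨t, ht⟩ := Submodule.mem_span_singleton.1 h
    exact hci (unit_of_mul _ _ ht).2
  obtain ⟨t, ht⟩ := hv w (by
    intro h; rw [← one_mul w, hmem] at h; exact h1c h)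
  obtain ⟨e, he⟩ := Submodule.mem_span_singleton.1 ht
  obtain ⟨v1, rfl⟩ : ∃ v1, v0 = v1 * w := ⟨e * c + t, by
    rw [add_mul, mul_assoc, ← hcw]; exact (sub_eq_iff_eq_add.1 he.symm)⟩
  rw [hmem] at h0
  have hv1 : ∀ s, s ∉ Submodule.span S {c} → ∃ t, v1 - t * s ∈ Submodule.span S {c} := by
    intro s hs
    obtain ⟨t, ht⟩ := hv (s * w) (by rwa [hmem])
    refine ⟨t, ?_⟩
    rw [← hmem, sub_mul, mul_assoc]; exact ht
  have hcL : c ∈ Submodule.span S {c} ⊔ Submodule.span S {v1} :=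
    Submodule.mem_sup_left (Submodule.mem_span_singleton_self _)
  have hvL : v1 ∈ Submodule.span S {c} ⊔ Submodule.span S {v1} :=
    Submodule.mem_sup_right (Submodule.mem_span_singleton_self _)
  obtain ⟨z', n, hz', h1, h2⟩ := H.struct (Submodule.span S {c} ⊔ Submodule.span S {v1}) (by
    intro h; rw [h, Submodule.mem_bot] at hcL; exact ne0 hc0 hcL)
  obtain ⟨w', hw'⟩ := h1 c hcL
  have hz'u : IsUnit z' := by
    refine (hcI _ _ hw').resolve_left fun hu => h0 ?_
    obtain ⟨a, ha⟩ := h1 v1 hvL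
    rw [ha, hw']
    exact Submodule.smul_mem _ a (span_unit_mul hu)
  have hXm := H.powX_mem _ hz'u h2
  obtain ⟨t', ht'⟩ := hv1 (X ^ (n + 1)) (by
    have := H.not_mem_pq hci hc0 one_ne_zero (n + 1)
    simpa using this)
  obtain ⟨e', he'⟩ := Submodule.mem_span_singleton.1 ht'
  obtain ⟨a, ha, b, hb, hab⟩ := Submodule.mem_sup.1 hXm
  obtain ⟨a, rfl⟩ := Submodule.mem_span_singleton.1 ha
  obtain ⟨b, rfl⟩ := Submodule.mem_span_singleton.1 hb
  apply hcu
  apply H.nonart_core hc0 (n := n) (s := b * t') (w := a + b * e')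
  have h3 : v1 = e' * c + t' * X ^ (n + 1) := sub_eq_iff_eq_add.1 he'.symm
  rw [← hab, h3]
  simp only [smul_eq_mul]
  noncomm_ring

theorem core2 (H : Setup X π ψ d) (L : Submodule S S) {v0 : S} (h0 : v0 ∉ L)
    (hv : ∀ s, s ∉ L → ∃ t, v0 - t * s ∈ L) {s1 : S} (hs1 : s1 ∉ L) (hXs1 : X * s1 ∈ L) :
    IsArtinian S (S ⧸ L) := by
  have hN := H.noeth
  have hmono := (monotone_stabilizes_iff_noetherian (R := S) (M := S)).2 hN
  have hc : ∀ a b, a - b ∈ L → ∀ r, r * b ∈ L → r * a ∈ L := by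
    intro a b h r hr
    have := L.add_mem (L.smul_mem r h) hr
    rwa [smul_eq_mul, mul_sub, sub_add_cancel] at this
  have hc' : ∀ a b, a - b ∈ L → b ∈ L → a ∈ L := by
    intro a b h hr
    have := L.add_mem h hr
    rwa [sub_add_cancel] at this
  have hXv : X * v0 ∈ L := by
    obtain ⟨t, ht⟩ := hv s1 hs1
    refine hc _ _ ht X ?_
    obtain ⟨t', ht'⟩ := H.normL t
    rw [← mul_assoc, ht', mul_assoc]
    exact L.smul_mem _ hXs1
  obtain ⟨n, hn⟩ : ∃ n, X ^ n ∈ L := by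
    obtain ⟨n, hn⟩ := hmono ⟨fun n => H.Kn L n, monotone_nat_of_le_succ (by
      intro n s hs
      change X ^ (n + 1) * s ∈ L
      rw [pow_succ', mul_assoc]
      exact L.smul_mem X hs)⟩
    refine ⟨n, by_contra fun hXn => ?_⟩
    obtain ⟨t, ht⟩ := hv _ hXn
    obtain ⟨t', ht', -⟩ := H.normRp n t
    rw [ht'] at ht
    have h1 : t' ∈ H.Kn L (n + 1) := by
      change X ^ (n + 1) * t' ∈ L
      rw [pow_succ', mul_assoc]
      refine hc _ v0 ?_ X hXv
      have := L.neg_mem ht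
      rwa [neg_sub] at this
    have h2 : t' ∈ H.Kn L n := by
      have := hn (n + 1) (by omega)
      change H.Kn L n = H.Kn L (n + 1) at this
      rwa [this]
    exact h0 (hc' _ _ ht h2)
  obtain ⟨f, hf0, hfv⟩ : ∃ f, π f ≠ 0 ∧ f * v0 ∈ L := by
    obtain ⟨y, hy⟩ := H.surj Polynomial.X
    by_cases hyv : y * v0 ∈ L
    · exact ⟨y, by rw [hy]; exact Polynomial.X_ne_zero, hyv⟩
    · obtain ⟨t, ht⟩ := hv _ hyv
      refine ⟨1 - t * y, ?_, by rwa [sub_mul, one_mul, mul_assoc]⟩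
      intro h
      rw [map_sub, map_one, map_mul, hy] at h
      have := congrArg (Polynomial.eval 0) h
      simp at this
  obtain ⟨f, hf0, hfv⟩ : ∃ f, π f ≠ 0 ∧ ∀ s, X * s ∈ L → f * s ∈ L := by
    obtain ⟨m, hm⟩ := hmono ⟨fun m => H.Jm L (f ^ m), monotone_nat_of_le_succ (by
      rintro m s ⟨hs, hs'⟩
      refine ⟨hs, ?_⟩
      rw [pow_succ', mul_assoc]
      exact L.smul_mem f hs')⟩
    refine ⟨f ^ m, by rw [map_pow]; exact pow_ne_zero _ hf0, fun s hs => by_contra fun hfs => ?_⟩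
    obtain ⟨t, ht⟩ := hv _ hfs
    have hts : X * (t * s) ∈ L := by
      obtain ⟨t', ht'⟩ := H.normL t
      rw [← mul_assoc, ht', mul_assoc]
      exact L.smul_mem _ hs
    obtain ⟨t', ht'⟩ := H.kerR (t * f ^ m - f ^ m * t) (by
        rw [map_sub, map_mul, map_mul, mul_comm, sub_self])
    have ht2 : v0 - f ^ m * (t * s) ∈ L := by
      have : v0 - f ^ m * (t * s) = (v0 - t * (f ^ m * s)) + t' * (X * s) := by
        rw [← mul_assoc t', ← ht']; noncomm_ring
      rw [this]; exact L.add_mem ht (L.smul_mem _ hs)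
    have h1 : t * s ∈ H.Jm L (f ^ (m + 1)) := by
      refine ⟨hts, ?_⟩
      rw [pow_succ', mul_assoc]
      refine hc _ v0 ?_ f hfv
      have := L.neg_mem ht2
      rwa [neg_sub] at this
    have h2 : t * s ∈ H.Jm L (f ^ m) := by
      have := hm (m + 1) (by omega)
      change H.Jm L (f ^ m) = H.Jm L (f ^ (m + 1)) at this
      rwa [this]
    exact h0 (hc' _ _ ht2 h2.2)
  have key : ∀ j s, X ^ j * s ∈ L → ∃ g, π g ≠ 0 ∧ g * s ∈ L := by
    intro j
    induction j with
    | zero => intro s hs; exact ⟨1, by simp, by simpa using hs⟩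
    | succ j ih =>
      intro s hs
      rw [pow_succ, mul_assoc] at hs
      obtain ⟨g, hg, hgs⟩ := ih _ hs
      obtain ⟨g', hg', hg0⟩ := H.normRp 1 g
      rw [pow_one] at hg'
      refine ⟨f * g', ?_, ?_⟩
      · rw [map_mul]; exact mul_ne_zero hf0 (hg0 hg)
      · rw [mul_assoc]; apply hfv
        rwa [← mul_assoc, ← hg', mul_assoc]
  obtain ⟨g, hg, hgL⟩ := key n 1 (by rwa [mul_one])
  rw [mul_one] at hgL
  exact H.art n L hn hgL hg

theorem core (H : Setup X π ψ d) (F : Fac π True) (L : Submodule S S) {v0 : S} (h0 : v0 ∉ L)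
    (hv : ∀ s, s ∉ L → ∃ t, v0 - t * s ∈ L) : IsArtinian S (S ⧸ L) := by
  by_cases h : ∀ s, X * s ∈ L → s ∈ L
  · exact H.core1 F L h0 hv h
  · push Not at h
    obtain ⟨s, h1, h2⟩ := h
    exact H.core2 L h0 hv h2 h1

theorem fac_diamond (H : Setup X π ψ d) (F : Fac π True) : HasDiamond S := by
  intro V E _ _ _ _ f hs hhull N hN
  obtain ⟨-, hfi, hess⟩ := hhull
  have hcyc : ∀ x : E, IsArtinian S (Submodule.span S {x}) := by
    intro x
    by_cases hx : x = 0
    · rw [hx, Submodule.span_zero_singleton]; infer_instance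
    let g : S →ₗ[S] E := LinearMap.toSpanSingleton S E x
    have h1 := hess (Submodule.span S {x}) (by simpa using hx)
    obtain ⟨y, ⟨hy, v, rfl⟩, hy0⟩ := (Submodule.ne_bot_iff _).1 h1
    obtain ⟨v0, hv0⟩ := Submodule.mem_span_singleton.1 hy
    have hart : IsArtinian S (S ⧸ LinearMap.ker g) := by
      refine H.core F _ (v0 := v0) (fun h => hy0 (by rw [← hv0]; exact h)) ?_
      intro s hs0
      have h2 := hess (Submodule.span S {s • x}) (by
        rw [Ne, Submodule.span_singleton_eq_bot]; exact hs0)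
      obtain ⟨y, ⟨hy', w, rfl⟩, hy0'⟩ := (Submodule.ne_bot_iff _).1 h2
      obtain ⟨a, ha⟩ := Submodule.mem_span_singleton.1 hy'
      have hw : w ≠ 0 := fun h => hy0' (by rw [h, map_zero])
      have h3 : v ∈ Submodule.span S {w} := by
        rw [(IsSimpleModule.span_singleton_eq_top S hw)]; trivial
      obtain ⟨b, hb⟩ := Submodule.mem_span_singleton.1 h3
      refine ⟨b * a, ?_⟩
      rw [LinearMap.mem_ker, map_sub, sub_eq_zero]
      change v0 • x = (b * a * s) • x
      rw [hv0, ← hb, map_smul, ← ha, smul_smul, smul_smul, mul_assoc]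
    have h3 : LinearMap.range g = Submodule.span S {x} := LinearMap.range_toSpanSingleton x
    rw [← h3]
    exact isArtinian_of_linearEquiv g.quotKerEquivRange
  obtain ⟨s, rfl⟩ := hN
  classical
  induction s using Finset.induction_on with
  | empty => rw [Finset.coe_empty, Submodule.span_empty]; infer_instance
  | insert a s ha ih =>
    rw [Finset.coe_insert, Submodule.span_insert]
    have := hcyc a
    infer_instance

end
end Setup

/-- finite dimensionality over the base field of a module over an algebra -/
def FD (k S M : Type u) [Field k] [Ring S] [Algebra k S] [AddCommGroup M] [Module S M] : Prop :=
  letI : Module k M := Module.compHom M (algebraMap k S)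
  Module.Finite k M

theorem FD_of {k S M : Type u} [Field k] [Ring S] [Algebra k S] [AddCommGroup M] [Module S M]
    {L : Submodule S S} (e : (S ⧸ L) ≃ₗ[S] M) (h : Module.Finite k (S ⧸ L)) : FD k S M := by
  unfold FD
  let _ : Module k M := Module.compHom M (algebraMap k S)
  let f : (S ⧸ L) →ₗ[k] M :=
    { toFun := e
      map_add' := map_add e
      map_smul' := fun c x => by
        rw [← algebraMap_smul S c x, map_smul]; rfl }
  exact Module.Finite.of_surjective f e.surjective

theorem FD_to {k S M : Type u} [Field k] [Ring S] [Algebra k S] [AddCommGroup M] [Module S M]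
    {L : Submodule S S} (e : (S ⧸ L) ≃ₗ[S] M) (h : FD k S M) : Module.Finite k (S ⧸ L) := by
  unfold FD at h
  let _ : Module k M := Module.compHom M (algebraMap k S)
  let f : M →ₗ[k] (S ⧸ L) :=
    { toFun := e.symm
      map_add' := map_add e.symm
      map_smul' := fun c x => by
        rw [RingHom.id_apply, ← algebraMap_smul S c (e.symm x), ← map_smul]; rfl }
  exact Module.Finite.of_surjective f e.symm.surjective

theorem kdim_of {A M : Type u} [Ring A] [AddCommGroup M] [Module A M]
    (h : ∀ N : Submodule A M, N ≠ ⊥ → IsArtinian A (M ⧸ N)) : KdimLE A 1 M := by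
  unfold KdimLE
  intro f hf
  have hanti : Antitone f := antitone_nat_of_succ_le hf
  by_cases hb : ∃ n, f n = ⊥
  · obtain ⟨n, hn⟩ := hb
    refine ⟨n, fun i hi => ?_⟩
    have hi0 : f i = ⊥ := le_bot_iff.1 (hn ▸ hanti hi)
    unfold KdimLE
    have : Subsingleton (f i) := by rw [hi0]; infer_instance
    infer_instance
  · push Not at hb
    refine ⟨0, fun i _ => ?_⟩
    unfold KdimLE
    have := h (f (i + 1)) (hb _)
    refine isArtinian_of_injective
      (Submodule.mapQ (Submodule.comap (f i).subtype (f (i + 1))) (f (i + 1)) (f i).subtype le_rfl) ?_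
    rw [← LinearMap.ker_eq_bot, Submodule.ker_mapQ, Submodule.mkQ_map_self]

namespace Setup
section
variable {k S T : Type u} [Field k] [Ring S] [Algebra k S] [Ring T] [IsDomain S] [IsDomain T]
    {X : S} {π : S →ₐ[k] Polynomial k} {ψ : S →+* T} {d : S → ℕ}

theorem d_core (H : Setup X π ψ d) (F : Fac π False) (L LV : Submodule S S) (hLV : IsCoatom LV)
    (hle : L ≤ LV) (hnot : ¬ IsArtinian S (S ⧸ L))
    (hL : ∀ P, L < P → IsArtinian S (S ⧸ P)) : Module.Finite k (S ⧸ LV) := by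
  by_contra hfin
  have hco : ∀ s, s ∉ LV → ∃ l ∈ LV, ∃ t, l + t * s = 1 := by
    intro s hs
    have h1 : LV ⊔ Submodule.span S {s} = ⊤ := by
      apply hLV.2
      rw [left_lt_sup, Submodule.span_singleton_le_iff_mem]; exact hs
    have h2 : (1 : S) ∈ LV ⊔ Submodule.span S {s} := by rw [h1]; trivial
    obtain ⟨l, hl, b, hb, hab⟩ := Submodule.mem_sup.1 h2
    obtain ⟨t, rfl⟩ := Submodule.mem_span_singleton.1 hb
    exact ⟨l, hl, t, hab⟩
  have hX : X ∉ LV := by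
    intro hX
    obtain ⟨y, hy⟩ := H.surj Polynomial.X
    by_cases hyL : y ∈ LV
    · exact hfin (H.fin_quot LV hX hyL (by rw [hy]; exact Polynomial.X_ne_zero))
    · obtain ⟨l, hl, t, ht⟩ := hco y hyL
      refine hfin (H.fin_quot LV hX hl ?_)
      intro h
      have h1 := congrArg π ht
      rw [map_add, h, map_mul, hy, map_one] at h1
      have := congrArg (Polynomial.eval 0) h1
      simp at this
  have hX1 : ∀ s, X * s ∈ LV → s ∈ LV := by
    intro s hs
    by_contra hcon
    obtain ⟨l, hl, t, ht⟩ := hco s hcon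
    apply hX
    obtain ⟨t', ht'⟩ := H.normL t
    have : X = X * l + t' * (X * s) := by
      rw [← mul_assoc, ← ht', mul_assoc, ← mul_add, ht, mul_one]
    rw [this]
    exact LV.add_mem (LV.smul_mem _ hl) (LV.smul_mem _ hs)
  have hXn : ∀ n s, X ^ n * s ∈ LV → s ∈ LV := by
    intro n
    induction n with
    | zero => intro s h; simpa using h
    | succ n ih =>
      intro s h
      apply ih
      apply hX1
      rwa [← mul_assoc, ← pow_succ']
  have hlt : ∀ s, s ∉ L → IsArtinian S (S ⧸ (L ⊔ Submodule.span S {s})) := by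
    intro s hs
    apply hL
    rw [left_lt_sup, Submodule.span_singleton_le_iff_mem]; exact hs
  obtain ⟨l, hl, hl0⟩ := H.art_exists L (hlt X fun h => hX (hle h))
  obtain ⟨z, n, hz, h1, h2⟩ := H.struct L (by
    rintro rfl; exact ne0 hl0 ((Submodule.mem_bot _).1 hl))
  have hzL : z ∈ L := by
    by_contra hzL
    obtain ⟨w, hw⟩ := h1 l hl
    apply hnot
    apply art_ext L z _ (hlt z hzL)
    apply H.art n _ (mem_colon.2 h2) (z := w) (mem_colon.2 (hw ▸ hl))
    rw [hw, map_mul] at hl0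
    exact left_ne_zero_of_mul hl0
  have hLz : L = Submodule.span S {z} := by
    apply le_antisymm
    · intro s hs
      obtain ⟨w, rfl⟩ := h1 s hs
      exact Submodule.mem_span_singleton.2 ⟨w, rfl⟩
    · simpa using hzL
  have hzu : ¬ IsUnit (π z) := fun h => hnot (by rw [hLz]; exact H.art_unit _ z rfl h)
  obtain ⟨w, c, hwc, hc⟩ := H.fac_right F _ z rfl hz hzu
  have hcu : ¬ IsUnit (π c) := hc.2.2.1
  have hLc' : L ≤ Submodule.span S {c} := by
    rw [hLz, Submodule.span_singleton_le_iff_mem, hwc]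
    exact Submodule.mem_span_singleton.2 ⟨w, rfl⟩
  have hLc : L = Submodule.span S {c} := by
    by_contra hne
    exact H.nonart hc.2.1 hcu (hL _ (lt_of_le_of_ne hLc' hne))
  have hcL : c ∈ LV := hle (hLc ▸ Submodule.mem_span_singleton_self c)
  obtain ⟨z', m, hz', h1', h2'⟩ := H.struct LV (by
    rintro rfl; exact ne0 hc.2.1 ((Submodule.mem_bot _).1 hcL))
  obtain ⟨w', hw'⟩ := h1' c hcL
  rcases hc.1.isUnit_or_isUnit hw' with hu | hu
  · have hz'c : LV ≤ Submodule.span S {c} := by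
      intro s hs
      obtain ⟨a, rfl⟩ := h1' s hs
      rw [hw']
      exact Submodule.smul_mem _ a (span_unit_mul hu)
    have hLL : L = LV := le_antisymm hle (hLc ▸ hz'c)
    have : IsSimpleModule S (S ⧸ LV) := isSimpleModule_iff_isCoatom.2 hLV
    apply hnot
    rw [hLL]; infer_instance
  · apply hLV.1
    obtain ⟨v, hv⟩ := hu.exists_left_inv
    rw [Ideal.eq_top_iff_one, ← hv]
    exact LV.smul_mem v (hXn m z' h2')

theorem fac_d (H : Setup X π ψ d) (F : Fac π False) {M : Type u} [AddCommGroup M] [Module S M]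
    {m : M} (hm : Submodule.span S {m} = ⊤) (hart : ¬ IsArtinian S M)
    (hcrit : ∀ N : Submodule S M, N ≠ ⊥ → IsArtinian S (M ⧸ N)) (N : Submodule S M)
    (hs : IsSimpleModule S (M ⧸ N)) : FD k S (M ⧸ N) := by
  let f : S →ₗ[S] M := LinearMap.toSpanSingleton S M m
  have hf : Function.Surjective f := by
    rw [← LinearMap.range_eq_top, LinearMap.range_toSpanSingleton, hm]
  let g : S →ₗ[S] (M ⧸ N) := N.mkQ.comp f
  have hg : Function.Surjective g := (N.mkQ_surjective).comp hf
  refine FD_of (g.quotKerEquivOfSurjective hg) (H.d_core F (LinearMap.ker f) _ ?_ ?_ ?_ ?_)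
  · rw [← isSimpleModule_iff_isCoatom]
    exact IsSimpleModule.congr (g.quotKerEquivOfSurjective hg)
  · exact LinearMap.ker_le_ker_comp _ _
  · intro h
    exact hart (isArtinian_of_linearEquiv (f.quotKerEquivOfSurjective hf))
  · intro P hP
    have hcm : (P.map f).comap f = P := by
      rw [Submodule.comap_map_eq, sup_eq_left]; exact hP.le
    have hne : P.map f ≠ ⊥ := by
      intro h
      rw [h] at hcm
      exact hP.ne hcm
    have := hcrit _ hne
    refine isArtinian_of_injective (Submodule.mapQ P (P.map f) f hcm.ge) ?_
    rw [← LinearMap.ker_eq_bot, Submodule.ker_mapQ, hcm, Submodule.mkQ_map_self]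

theorem d_fac (H : Setup X π ψ d)
    (hinf : ∀ p : Polynomial k, p ≠ 0 → ∃ n u, IsUnit u ∧ Polynomial.aeval X p = X ^ n * u)
    (hd : ¬ ∃ (M : Type u) (_ : AddCommGroup M) (_ : Module S M),
          (∃ m : M, Submodule.span S {m} = ⊤) ∧ IsOneCritical S M ∧
          ∃ N : Submodule S M, IsSimpleModule S (M ⧸ N) ∧ ¬ FD k S (M ⧸ N)) : Fac π False := by
  intro p q hp hq
  by_contra hno
  apply hd
  have hqu : IsUnit (π q) := hq.2.2.2 not_false
  have hqs : IsSimpleModule S (lQuot S q) := H.simpleB hq.1 hqu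
  have hcr : ∀ N : Submodule S (lQuot S (p * q)), N ≠ ⊥ → IsArtinian S (lQuot S (p * q) ⧸ N) := by
    intro W hW
    set Q := lSpan S (p * q) with hQ
    have hle : Q ≤ W.comap Q.mkQ := by
      intro x hx
      rw [Submodule.mem_comap, Submodule.mkQ_apply, (Submodule.Quotient.mk_eq_zero _).2 hx]
      exact Submodule.zero_mem _
    have hlt : Q < W.comap Q.mkQ := by
      refine lt_of_le_of_ne hle ?_
      intro h; apply hW
      rw [eq_bot_iff]
      intro x hx
      obtain ⟨y, rfl⟩ := Submodule.mkQ_surjective _ x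
      have h1 : y ∈ W.comap Q.mkQ := hx
      rw [← h] at h1
      exact (Submodule.Quotient.mk_eq_zero _).2 h1
    obtain ⟨n, hn⟩ := H.above hp hq hno _ hlt
    have h1 : IsArtinian S (S ⧸ (W.comap Q.mkQ)) := by
      apply art_ext _ q
      · exact H.art n _ (mem_colon.2 hn) (z := p)
          (mem_colon.2 (hle (Submodule.mem_span_singleton_self _))) hp.2.1
      · exact art_le le_sup_right (H.art_unit _ q rfl hqu)
    refine isArtinian_of_surjective (S ⧸ (W.comap Q.mkQ))
      (Submodule.mapQ (W.comap Q.mkQ) W Q.mkQ le_rfl) ?_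
    intro y
    obtain ⟨y, rfl⟩ := Submodule.mkQ_surjective _ y
    obtain ⟨y, rfl⟩ := Submodule.mkQ_surjective _ y
    exact ⟨Submodule.Quotient.mk y, rfl⟩
  obtain ⟨eQ⟩ := quotEquiv (span_le_mul p q)
  refine ⟨lQuot S (p * q), inferInstance, inferInstance, ⟨Submodule.Quotient.mk 1, ?_⟩,
    ⟨kdim_of hcr, ?_, hcr⟩, (lSpan S q).map (lSpan S (p * q)).mkQ, ?_, ?_⟩
  · rw [eq_top_iff]
    rintro x -
    obtain ⟨y, rfl⟩ := Submodule.mkQ_surjective _ x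
    refine Submodule.mem_span_singleton.2 ⟨y, ?_⟩
    rw [← Submodule.Quotient.mk_smul, smul_eq_mul, mul_one]; rfl
  · refine H.nonart (z := p * q) ?_ ?_
    · rw [map_mul]; exact mul_ne_zero hp.2.1 hq.2.1
    · rw [map_mul, IsUnit.mul_iff, hp.2.2]; tauto
  · exact IsSimpleModule.congr eQ
  · intro h
    have hfin : Module.Finite k (lQuot S q) := FD_to eQ.symm h
    let f : Polynomial k →ₗ[k] lQuot S q :=
      ((lSpan S q).mkQ.restrictScalars k).comp (Polynomial.aeval X).toLinearMap
    have hfi : Function.Injective f := by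
      rw [← LinearMap.ker_eq_bot, eq_bot_iff]
      intro P hP
      rw [Submodule.mem_bot]
      by_contra hP0
      obtain ⟨n, u, hu, he⟩ := hinf P hP0
      have h1 : Polynomial.aeval X P ∈ lSpan S q := (Submodule.Quotient.mk_eq_zero _).1 hP
      rw [he] at h1
      have h2 := H.powX_mem _ hu h1
      have := H.not_mem_pq hq.1.not_isUnit hq.2.1 one_ne_zero n
      rw [mul_one, mul_one] at this
      exact this h2
    have := Module.Finite.of_injective f hfi
    exact Polynomial.not_finite this

end
end Setup

namespace SkewAux
section
variable {k : Type u} [Field k]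
    {R : Type u} [CommRing R] [IsDomain R] [IsDiscreteValuationRing R] [Algebra k R]
    {X : R} {α : R ≃ₐ[k] R} {S : Type u} [Ring S] {φ : R →+* S} {θ : S}

/-- additive equivalence between polynomials and skew polynomials -/
noncomputable def toE (hS : IsSkewPolynomialRing α.toRingEquiv φ θ) : Polynomial R ≃+ S :=
  { Equiv.ofBijective (fun p : Polynomial R => p.sum fun n r => φ r * θ ^ n) (by
      have h1 : Function.Bijective (fun p : Polynomial R => p.toFinsupp.coeff) := by
        constructor
        · rintro ⟨⟨p⟩⟩ ⟨⟨q⟩⟩ h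
          congr
        · intro p
          exact ⟨⟨⟨p⟩⟩, rfl⟩
      exact hS.bijective.comp h1) with
    map_add' := by
      intro p q
      exact Polynomial.sum_add_index p q (fun n r => φ r * θ ^ n) (by simp) (by intro a b c; simp [add_mul]) }

theorem toE_apply (hS : IsSkewPolynomialRing α.toRingEquiv φ θ) (p : Polynomial R) :
    toE hS p = p.sum fun n r => φ r * θ ^ n := rfl

theorem toE_monomial (hS : IsSkewPolynomialRing α.toRingEquiv φ θ) (n : ℕ) (r : R) :
    toE hS (Polynomial.monomial n r) = φ r * θ ^ n := by
  rw [toE_apply, Polynomial.sum_monomial_index _ _ (by simp)]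

/-- the coefficient polynomial -/
noncomputable abbrev cp (hS : IsSkewPolynomialRing α.toRingEquiv φ θ) : S ≃+ Polynomial R :=
  (toE hS).symm

theorem cp_monomial (hS : IsSkewPolynomialRing α.toRingEquiv φ θ) (n : ℕ) (r : R) :
    cp hS (φ r * θ ^ n) = Polynomial.monomial n r := by
  rw [← toE_monomial hS, AddEquiv.symm_apply_apply]

theorem cp_phi (hS : IsSkewPolynomialRing α.toRingEquiv φ θ) (r : R) :
    cp hS (φ r) = Polynomial.C r := by
  have := cp_monomial hS 0 r
  rwa [pow_zero, mul_one] at this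

theorem ind (hS : IsSkewPolynomialRing α.toRingEquiv φ θ) {P : S → Prop}
    (h1 : ∀ a b, P a → P b → P (a + b)) (h2 : ∀ r n, P (φ r * θ ^ n)) (s : S) : P s := by
  rw [← (toE hS).apply_symm_apply s]
  induction (toE hS).symm s using Polynomial.induction_on' with
  | add p q hp hq => rw [map_add]; exact h1 _ _ hp hq
  | monomial n a => rw [toE_monomial]; exact h2 _ _

theorem theta_pow (hS : IsSkewPolynomialRing α.toRingEquiv φ θ) (n : ℕ) (r : R) :
    θ ^ n * φ r = φ ((α ^ n) r) * θ ^ n := by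
  induction n generalizing r with
  | zero => simp
  | succ n ih =>
    have h := hS.commutes r
    rw [pow_succ, mul_assoc, h, ← mul_assoc, ih, mul_assoc, pow_succ]
    rfl

theorem mon_mul (hS : IsSkewPolynomialRing α.toRingEquiv φ θ) (i j : ℕ) (a b : R) :
    (φ a * θ ^ i) * (φ b * θ ^ j) = φ (a * (α ^ i) b) * θ ^ (i + j) := by
  rw [map_mul, pow_add, mul_assoc, ← mul_assoc (θ ^ i), theta_pow hS]
  simp only [mul_assoc]

theorem coeff_mul (hS : IsSkewPolynomialRing α.toRingEquiv φ θ) (s t : S) (n : ℕ) :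
    (cp hS (s * t)).coeff n = ∑ x ∈ Finset.HasAntidiagonal.antidiagonal n,
      (cp hS s).coeff x.1 * (α ^ x.1) ((cp hS t).coeff x.2) := by
  induction s using ind hS with
  | h1 a b ha hb =>
    simp only [add_mul, map_add, Polynomial.coeff_add, ha, hb, Finset.sum_add_distrib]
  | h2 a i =>
    induction t using ind hS with
    | h1 c d hc hd =>
      simp only [mul_add, map_add, Polynomial.coeff_add, hc, hd, Finset.sum_add_distrib]
    | h2 b j =>
      rw [mon_mul hS, cp_monomial, cp_monomial, cp_monomial]
      simp only [Polynomial.coeff_monomial]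
      by_cases h : i + j = n
      · rw [if_pos h, Finset.sum_eq_single (i, j)]
        · simp
        · rintro ⟨x, y⟩ hxy hne
          by_cases hx : i = x
          · rw [if_neg (c := j = y), map_zero, mul_zero]
            rintro rfl; exact hne (by rw [hx])
          · rw [if_neg hx, zero_mul]
        · intro hn
          exact absurd (Finset.HasAntidiagonal.mem_antidiagonal.2 h) hn
      · rw [if_neg h]
        symm
        apply Finset.sum_eq_zero
        rintro ⟨x, y⟩ hxy
        rw [Finset.HasAntidiagonal.mem_antidiagonal] at hxy
        by_cases hx : i = x
        · rw [if_neg (c := j = y), map_zero, mul_zero]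
          rintro rfl; exact h (by rw [hx]; exact hxy)
        · rw [if_neg hx, zero_mul]

theorem coeff_top (hS : IsSkewPolynomialRing α.toRingEquiv φ θ) (s t : S) {m n l : ℕ}
    (hs : (cp hS s).natDegree ≤ m) (ht : (cp hS t).natDegree ≤ n) (hl : l = m + n) :
    (cp hS (s * t)).coeff l = (cp hS s).coeff m * (α ^ m) ((cp hS t).coeff n) := by
  rw [coeff_mul, Finset.sum_eq_single (m, n)]
  · rintro ⟨x, y⟩ hxy hne
    rw [Finset.HasAntidiagonal.mem_antidiagonal] at hxy
    rcases lt_or_ge m x with h | h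
    · rw [Polynomial.coeff_eq_zero_of_natDegree_lt (lt_of_le_of_lt hs h), zero_mul]
    · have h2 : n < y := by
        simp only at hxy
        by_contra h3
        apply hne
        ext <;> simp only <;> omega
      rw [Polynomial.coeff_eq_zero_of_natDegree_lt (lt_of_le_of_lt ht h2), map_zero, mul_zero]
  · intro hn
    exact absurd (Finset.HasAntidiagonal.mem_antidiagonal.2 hl.symm) hn

theorem coeff_big (hS : IsSkewPolynomialRing α.toRingEquiv φ θ) (s t : S) {m n l : ℕ}
    (hs : (cp hS s).natDegree ≤ m) (ht : (cp hS t).natDegree ≤ n) (hl : m + n < l) :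
    (cp hS (s * t)).coeff l = 0 := by
  rw [coeff_mul]
  apply Finset.sum_eq_zero
  rintro ⟨x, y⟩ hxy
  rw [Finset.HasAntidiagonal.mem_antidiagonal] at hxy
  simp only at hxy
  rcases lt_or_ge m x with h | h
  · rw [Polynomial.coeff_eq_zero_of_natDegree_lt (lt_of_le_of_lt hs h), zero_mul]
  · rw [Polynomial.coeff_eq_zero_of_natDegree_lt (lt_of_le_of_lt ht (by omega)), map_zero,
      mul_zero]

theorem lc_ne (hS : IsSkewPolynomialRing α.toRingEquiv φ θ) {s : S} (hs : s ≠ 0) :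
    (cp hS s).coeff (cp hS s).natDegree ≠ 0 := by
  rw [Polynomial.coeff_natDegree, Polynomial.leadingCoeff_ne_zero]
  simpa using hs

theorem coeff_mul_ne (hS : IsSkewPolynomialRing α.toRingEquiv φ θ) {s t : S} (hs : s ≠ 0)
    (ht : t ≠ 0) :
    (cp hS (s * t)).coeff ((cp hS s).natDegree + (cp hS t).natDegree) ≠ 0 := by
  rw [coeff_top hS s t le_rfl le_rfl rfl]
  refine mul_ne_zero (lc_ne hS hs) ?_
  rw [Ne, EmbeddingLike.map_eq_zero_iff]
  exact lc_ne hS ht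

theorem domS (hS : IsSkewPolynomialRing α.toRingEquiv φ θ) : IsDomain S := by
  have : Nontrivial S := by
    refine ⟨0, 1, fun h => ?_⟩
    have h1 := cp_phi hS 1
    rw [map_one, ← h, map_zero, Polynomial.C_1] at h1
    exact zero_ne_one h1
  have : NoZeroDivisors S := by
    constructor
    intro a b hab
    by_contra! hcon
    have := coeff_mul_ne hS hcon.1 hcon.2
    rw [hab, map_zero, Polynomial.coeff_zero] at this
    exact this rfl
  exact NoZeroDivisors.to_isDomain S

/-- degree -/
noncomputable def deg (hS : IsSkewPolynomialRing α.toRingEquiv φ θ) (s : S) : ℕ :=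
  (cp hS s).natDegree

theorem deg_mul (hS : IsSkewPolynomialRing α.toRingEquiv φ θ) (s t : S) (hs : s ≠ 0)
    (ht : t ≠ 0) : deg hS (s * t) = deg hS s + deg hS t := by
  apply le_antisymm
  · exact Polynomial.natDegree_le_iff_coeff_eq_zero.2 fun l hl => coeff_big hS s t le_rfl le_rfl hl
  · exact Polynomial.le_natDegree_of_ne_zero (coeff_mul_ne hS hs ht)

theorem irr (hX : IsLocalRing.maximalIdeal R = Ideal.span {X}) : Irreducible X :=
  (IsDiscreteValuationRing.irreducible_iff_uniformizer X).2 hX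

theorem assocX (hX : IsLocalRing.maximalIdeal R = Ideal.span {X}) (α : R ≃ₐ[k] R) (n : ℕ) :
    Associated ((α ^ n) X) X :=
  IsDiscreteValuationRing.associated_of_irreducible R
    ((MulEquiv.irreducible_iff (α ^ n)).2 (irr hX)) (irr hX)

theorem dvd_pow (hX : IsLocalRing.maximalIdeal R = Ideal.span {X}) {b : R} (hb : b ≠ 0) :
    ∃ e, b ∣ X ^ e := by
  obtain ⟨e, h⟩ := IsDiscreteValuationRing.associated_pow_irreducible hb (irr hX)
  exact ⟨e, h.dvd⟩

theorem dvd_pow' (hX : IsLocalRing.maximalIdeal R = Ideal.span {X}) (α : R ≃ₐ[k] R) (n : ℕ)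
    {b : R} (hb : b ≠ 0) : ∃ e, b ∣ (α ^ n) (X ^ e) := by
  obtain ⟨e, h⟩ := dvd_pow hX hb
  refine ⟨e, h.trans ?_⟩
  rw [map_pow]
  exact pow_dvd_pow_of_dvd (assocX hX α n).symm.dvd e

theorem deg_phi (hS : IsSkewPolynomialRing α.toRingEquiv φ θ) (r : R) :
    (cp hS (φ r)).natDegree ≤ 0 := by
  rw [cp_phi, Polynomial.natDegree_C]

theorem deg_mon (hS : IsSkewPolynomialRing α.toRingEquiv φ θ) (r : R) (n : ℕ) :
    (cp hS (φ r * θ ^ n)).natDegree ≤ n := by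
  rw [cp_monomial]; exact Polynomial.natDegree_monomial_le _

theorem euL (hS : IsSkewPolynomialRing α.toRingEquiv φ θ)
    (hX : IsLocalRing.maximalIdeal R = Ideal.span {X}) (a b : S) (hb : b ≠ 0) :
    ∃ n q r, φ X ^ n * a = q * b + r ∧ (r = 0 ∨ deg hS r < deg hS b) := by
  have key : ∀ (N : ℕ) (a : S), (∀ i, N ≤ i → (cp hS a).coeff i = 0) →
      ∃ n q r, φ X ^ n * a = q * b + r ∧ (r = 0 ∨ deg hS r < deg hS b) := by
    intro N
    induction N with
    | zero =>
      intro a ha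
      have : cp hS a = 0 := Polynomial.ext fun i => by rw [ha i (by omega), Polynomial.coeff_zero]
      have : a = 0 := by simpa using this
      exact ⟨0, 0, 0, by simp [this], Or.inl rfl⟩
    | succ N ih =>
      intro a ha
      have hda : (cp hS a).natDegree ≤ N :=
        Polynomial.natDegree_le_iff_coeff_eq_zero.2 fun i hi => ha i hi
      rcases lt_or_ge N (deg hS b) with hN | hN
      · exact ⟨0, 0, a, by simp, Or.inr (lt_of_le_of_lt hda hN)⟩
      obtain ⟨m, rfl⟩ := Nat.exists_eq_add_of_le' hN
      have hlb := lc_ne hS hb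
      set β := (cp hS b).coeff (cp hS b).natDegree with hβ
      have hβ' : (α ^ m) β ≠ 0 := by rwa [Ne, EmbeddingLike.map_eq_zero_iff]
      obtain ⟨e, y, hy⟩ := dvd_pow hX hβ'
      obtain ⟨n, q, r, h1, h2⟩ := ih
        (φ (X ^ e) * a - φ (y * (cp hS a).coeff (m + deg hS b)) * θ ^ m * b) (by
          intro i hi
          rw [map_sub, Polynomial.coeff_sub]
          rcases hi.eq_or_lt with rfl | hi
          · rw [coeff_top hS _ _ (deg_phi hS _) hda (zero_add _).symm,
              coeff_top hS _ b (l := m + deg hS b) (n := (cp hS b).natDegree) (deg_mon hS _ _) le_rfl rfl, cp_phi, cp_monomial]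
            simp only [Polynomial.coeff_C_zero, pow_zero, AlgEquiv.one_apply,
              Polynomial.coeff_monomial, if_true]
            rw [hy, ← hβ]; ring
          · rw [coeff_big hS _ _ (deg_phi hS _) hda (by omega),
              coeff_big hS _ b (n := (cp hS b).natDegree) (deg_mon hS _ _) le_rfl hi, sub_zero])
      refine ⟨n + e, q + φ X ^ n * (φ (y * (cp hS a).coeff (m + deg hS b)) * θ ^ m), r, ?_, h2⟩
      rw [mul_sub, sub_eq_iff_eq_add] at h1
      rw [pow_add, mul_assoc, ← map_pow φ X e, h1, add_mul]
      simp only [mul_assoc]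
      abel
  exact key ((cp hS a).natDegree + 1) a fun i hi =>
    Polynomial.coeff_eq_zero_of_natDegree_lt (by omega)

theorem euR (hS : IsSkewPolynomialRing α.toRingEquiv φ θ)
    (hX : IsLocalRing.maximalIdeal R = Ideal.span {X}) (a b : S) (hb : b ≠ 0) :
    ∃ n q r, a * φ X ^ n = b * q + r ∧ (r = 0 ∨ deg hS r < deg hS b) := by
  have key : ∀ (N : ℕ) (a : S), (∀ i, N ≤ i → (cp hS a).coeff i = 0) →
      ∃ n q r, a * φ X ^ n = b * q + r ∧ (r = 0 ∨ deg hS r < deg hS b) := by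
    intro N
    induction N with
    | zero =>
      intro a ha
      have : cp hS a = 0 := Polynomial.ext fun i => by rw [ha i (by omega), Polynomial.coeff_zero]
      have : a = 0 := by simpa using this
      exact ⟨0, 0, 0, by simp [this], Or.inl rfl⟩
    | succ N ih =>
      intro a ha
      have hda : (cp hS a).natDegree ≤ N :=
        Polynomial.natDegree_le_iff_coeff_eq_zero.2 fun i hi => ha i hi
      rcases lt_or_ge N (deg hS b) with hN | hN
      · exact ⟨0, 0, a, by simp, Or.inr (lt_of_le_of_lt hda hN)⟩
      obtain ⟨m, rfl⟩ := Nat.exists_eq_add_of_le hN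
      have hlb := lc_ne hS hb
      set β := (cp hS b).coeff (cp hS b).natDegree with hβ
      obtain ⟨e, y, hy⟩ := dvd_pow' hX α (deg hS b + m) hlb
      obtain ⟨v, hv⟩ := (α ^ (cp hS b).natDegree).surjective
        ((cp hS a).coeff (deg hS b + m) * y)
      obtain ⟨n, q, r, h1, h2⟩ := ih
        (a * φ (X ^ e) - b * (φ v * θ ^ m)) (by
          intro i hi
          rw [map_sub, Polynomial.coeff_sub]
          rcases hi.eq_or_lt with rfl | hi
          · rw [coeff_top hS _ _ hda (deg_phi hS _) (add_zero _).symm,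
              coeff_top hS b _ (l := deg hS b + m) (m := (cp hS b).natDegree) le_rfl (deg_mon hS _ _) rfl, cp_phi, cp_monomial]
            simp only [Polynomial.coeff_C_zero, Polynomial.coeff_monomial, if_true]
            rw [hv, hy, ← hβ]; ring
          · rw [coeff_big hS _ _ hda (deg_phi hS _) (by omega),
              coeff_big hS b _ (m := (cp hS b).natDegree) le_rfl (deg_mon hS _ _) hi, sub_zero])
      refine ⟨e + n, q + φ v * θ ^ m * φ X ^ n, r, ?_, h2⟩
      rw [sub_mul, sub_eq_iff_eq_add] at h1
      rw [pow_add, ← mul_assoc, ← map_pow φ X e, h1, mul_add]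
      simp only [mul_assoc]
      abel
  exact key ((cp hS a).natDegree + 1) a fun i hi =>
    Polynomial.coeff_eq_zero_of_natDegree_lt (by omega)

end
end SkewAux

namespace SkewAux
section
variable {k : Type u} [Field k]
    {R : Type u} [CommRing R] [IsDomain R] [IsDiscreteValuationRing R] [Algebra k R]
    {X : R} {α : R ≃ₐ[k] R} {S : Type u} [Ring S] {φ : R →+* S} {θ : S}

/-- the residue map `R → k` -/
noncomputable def rho (hres : Function.Bijective ((IsLocalRing.residue R).comp (algebraMap k R))) :
    R →+* k :=
  ((RingEquiv.ofBijective _ hres).symm : IsLocalRing.ResidueField R →+* k).comp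
    (IsLocalRing.residue R)

theorem rho_alg (hres : Function.Bijective ((IsLocalRing.residue R).comp (algebraMap k R)))
    (c : k) : rho hres (algebraMap k R c) = c := by
  show (RingEquiv.ofBijective _ hres).symm
    ((RingEquiv.ofBijective _ hres) c) = c
  exact RingEquiv.symm_apply_apply _ _

theorem rho_zero (hres : Function.Bijective ((IsLocalRing.residue R).comp (algebraMap k R)))
    (r : R) : rho hres r = 0 ↔ ¬ IsUnit r := by
  show (RingEquiv.ofBijective _ hres).symm (IsLocalRing.residue R r) = 0 ↔ _
  rw [EmbeddingLike.map_eq_zero_iff, IsLocalRing.residue_eq_zero_iff, IsLocalRing.mem_maximalIdeal,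
    mem_nonunits_iff]

theorem rho_dvd (hX : IsLocalRing.maximalIdeal R = Ideal.span {X})
    (hres : Function.Bijective ((IsLocalRing.residue R).comp (algebraMap k R)))
    (r : R) : rho hres r = 0 ↔ X ∣ r := by
  rw [rho_zero, ← mem_nonunits_iff, ← IsLocalRing.mem_maximalIdeal, hX, Ideal.mem_span_singleton]

theorem rho_alpha (hres : Function.Bijective ((IsLocalRing.residue R).comp (algebraMap k R)))
    (α : R ≃ₐ[k] R) (r : R) : rho hres (α r) = rho hres r := by
  have h1 : rho hres (r - algebraMap k R (rho hres r)) = 0 := by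
    rw [map_sub, rho_alg, sub_self]
  have h2 : rho hres (α (r - algebraMap k R (rho hres r))) = 0 := by
    rw [rho_zero] at h1 ⊢
    rwa [MulEquiv.isUnit_map]
  rw [map_sub, AlgEquiv.commutes, map_sub, rho_alg, sub_eq_zero] at h2
  exact h2

/-- the algebra structure -/
noncomputable abbrev algS (hS : IsSkewPolynomialRing α.toRingEquiv φ θ) : Algebra k S :=
  (φ.comp (algebraMap k R)).toAlgebra' (by
    intro c s
    induction s using ind hS with
    | h1 a b ha hb => rw [mul_add, add_mul, ha, hb]
    | h2 r n =>
      rw [RingHom.comp_apply, mul_assoc, theta_pow hS, AlgEquiv.commutes, ← mul_assoc, ← mul_assoc,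
        ← map_mul, ← map_mul, mul_comm])

/-- The ring map `S → k[θ]`. -/
noncomputable def piR (hS : IsSkewPolynomialRing α.toRingEquiv φ θ)
    (hres : Function.Bijective ((IsLocalRing.residue R).comp (algebraMap k R))) :
    S →+* Polynomial k where
  toFun s := (cp hS s).map (rho hres)
  map_one' := by
    have := cp_phi hS 1
    rw [map_one] at this
    rw [this, Polynomial.C_1, Polynomial.map_one]
  map_zero' := by rw [map_zero, Polynomial.map_zero]
  map_add' a b := by rw [map_add, Polynomial.map_add]
  map_mul' s t := by
    induction s using ind hS with
    | h1 a b ha hb => simp only [add_mul, map_add, Polynomial.map_add, ha, hb]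
    | h2 a i =>
      induction t using ind hS with
      | h1 c d hc hd => simp only [mul_add, map_add, Polynomial.map_add, hc, hd]
      | h2 b j =>
        rw [mon_mul hS, cp_monomial, cp_monomial, cp_monomial]
        simp only [Polynomial.map_monomial, Polynomial.monomial_mul_monomial, map_mul, rho_alpha]

theorem piR_apply (hS : IsSkewPolynomialRing α.toRingEquiv φ θ)
    (hres : Function.Bijective ((IsLocalRing.residue R).comp (algebraMap k R))) (s : S) :
    piR hS hres s = (cp hS s).map (rho hres) := rfl

theorem piR_mon (hS : IsSkewPolynomialRing α.toRingEquiv φ θ)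
    (hres : Function.Bijective ((IsLocalRing.residue R).comp (algebraMap k R))) (r : R) (n : ℕ) :
    piR hS hres (φ r * θ ^ n) = Polynomial.monomial n (rho hres r) := by
  rw [piR_apply, cp_monomial, Polynomial.map_monomial]

theorem piR_phi (hS : IsSkewPolynomialRing α.toRingEquiv φ θ)
    (hres : Function.Bijective ((IsLocalRing.residue R).comp (algebraMap k R))) (r : R) :
    piR hS hres (φ r) = Polynomial.C (rho hres r) := by
  rw [piR_apply, cp_phi, Polynomial.map_C]

theorem piR_theta (hS : IsSkewPolynomialRing α.toRingEquiv φ θ)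
    (hres : Function.Bijective ((IsLocalRing.residue R).comp (algebraMap k R)))
    (p : Polynomial k) : piR hS hres (thetaPoly φ θ p) = p := by
  unfold thetaPoly
  conv_rhs => rw [← Polynomial.sum_monomial_eq p]
  rw [Polynomial.sum, Polynomial.sum, map_sum]
  refine Finset.sum_congr rfl fun n _ => ?_
  rw [piR_mon, rho_alg]

/-- The algebra map. -/
noncomputable def piA (hS : IsSkewPolynomialRing α.toRingEquiv φ θ)
    (hres : Function.Bijective ((IsLocalRing.residue R).comp (algebraMap k R))) :
    letI := algS hS
    S →ₐ[k] Polynomial k :=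
  letI := algS hS
  { piR hS hres with
    commutes' := by
      intro c
      show piR hS hres (φ (algebraMap k R c)) = _
      rw [piR_phi, rho_alg]; rfl }

theorem kerL (hS : IsSkewPolynomialRing α.toRingEquiv φ θ)
    (hX : IsLocalRing.maximalIdeal R = Ideal.span {X})
    (hres : Function.Bijective ((IsLocalRing.residue R).comp (algebraMap k R))) (s : S)
    (h : piR hS hres s = 0) : ∃ t, s = φ X * t := by
  have h1 : Polynomial.C X ∣ cp hS s := by
    rw [Polynomial.C_dvd_iff_dvd_coeff]
    intro i
    rw [← rho_dvd hX hres, ← Polynomial.coeff_map, ← piR_apply, h, Polynomial.coeff_zero]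
  obtain ⟨g, hg⟩ := h1
  refine ⟨toE hS g, ?_⟩
  rw [← (toE hS).apply_symm_apply s, show (toE hS).symm s = _ from hg]
  clear hg
  induction g using Polynomial.induction_on' with
  | add p q hp hq => rw [mul_add, map_add, map_add, mul_add, hp, hq]
  | monomial n a =>
    rw [Polynomial.C_mul_monomial, toE_monomial, toE_monomial, map_mul, mul_assoc]

theorem kerR (hS : IsSkewPolynomialRing α.toRingEquiv φ θ)
    (hX : IsLocalRing.maximalIdeal R = Ideal.span {X})
    (hres : Function.Bijective ((IsLocalRing.residue R).comp (algebraMap k R))) (s : S)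
    (h : piR hS hres s = 0) : ∃ t, s = t * φ X := by
  obtain ⟨t, rfl⟩ := kerL hS hX hres s h
  clear h
  induction t using ind hS with
  | h1 a b ha hb =>
    obtain ⟨u, hu⟩ := ha
    obtain ⟨v, hv⟩ := hb
    exact ⟨u + v, by rw [mul_add, add_mul, hu, hv]⟩
  | h2 r n =>
    obtain ⟨g, hg⟩ := (assocX hX α n).dvd
    refine ⟨φ (r * g) * θ ^ n, ?_⟩
    rw [mul_assoc, theta_pow hS, ← mul_assoc, ← mul_assoc, ← map_mul, ← map_mul]
    congr 2
    conv_lhs => rw [hg]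
    ring

theorem normal (hS : IsSkewPolynomialRing α.toRingEquiv φ θ)
    (hX : IsLocalRing.maximalIdeal R = Ideal.span {X})
    (hres : Function.Bijective ((IsLocalRing.residue R).comp (algebraMap k R))) (n : ℕ) (s : S) :
    ∃ t, φ X ^ n * s = t * φ X ^ n := by
  induction n generalizing s with
  | zero => exact ⟨s, by simp⟩
  | succ n ih =>
    obtain ⟨t, ht⟩ := ih s
    obtain ⟨v, hv⟩ := kerR hS hX hres (φ X * t) (by
      rw [map_mul, piR_phi, (rho_dvd hX hres X).2 dvd_rfl, Polynomial.C_0, zero_mul])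
    exact ⟨v, by rw [pow_succ', mul_assoc, ht, ← mul_assoc, hv, mul_assoc]⟩

theorem coeff_phi_mul (hS : IsSkewPolynomialRing α.toRingEquiv φ θ) (r : R) (s : S) (n : ℕ) :
    (cp hS (φ r * s)).coeff n = r * (cp hS s).coeff n := by
  induction s using ind hS with
  | h1 a b ha hb => simp only [mul_add, map_add, Polynomial.coeff_add, ha, hb]
  | h2 b j =>
    rw [← mul_assoc, ← map_mul, cp_monomial, cp_monomial, Polynomial.coeff_monomial,
      Polynomial.coeff_monomial, mul_ite, mul_zero]

theorem locL (hS : IsSkewPolynomialRing α.toRingEquiv φ θ)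
    (hX : IsLocalRing.maximalIdeal R = Ideal.span {X})
    (hres : Function.Bijective ((IsLocalRing.residue R).comp (algebraMap k R)))
    {T : Type u} [Ring T] {ψ : S →+* T} (hT : IsLocalizationAt (φ X) ψ) (t : T) :
    ∃ (s : S) (n : ℕ), ψ (φ X) ^ n * t = ψ s := by
  obtain ⟨s, n, h⟩ := hT.surj t
  obtain ⟨v, hv⟩ := normal hS hX hres n s
  refine ⟨v, n, ?_⟩
  apply (hT.unit.pow n).mul_right_cancel
  rw [mul_assoc, h, ← map_pow, ← map_mul, hv, map_mul]

theorem domT (hS : IsSkewPolynomialRing α.toRingEquiv φ θ)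
    (hX : IsLocalRing.maximalIdeal R = Ideal.span {X})
    (hres : Function.Bijective ((IsLocalRing.residue R).comp (algebraMap k R)))
    {T : Type u} [Ring T] {ψ : S →+* T} (hT : IsLocalizationAt (φ X) ψ) : IsDomain T := by
  have := domS hS
  have : Nontrivial T := hT.inj.nontrivial
  have : NoZeroDivisors T := by
    constructor
    intro a b hab
    obtain ⟨s, n, h⟩ := locL hS hX hres hT a
    obtain ⟨t, m, h'⟩ := hT.surj b
    have : ψ (s * t) = 0 := by
      rw [map_mul, ← h, ← h', mul_assoc, ← mul_assoc a, hab, zero_mul, mul_zero]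
    rw [map_eq_zero_iff ψ hT.inj, mul_eq_zero] at this
    rcases this with rfl | rfl
    · left
      rw [map_zero] at h
      exact (hT.unit.pow n).mul_right_eq_zero.1 h
    · right
      rw [map_zero] at h'
      exact (hT.unit.pow m).mul_left_eq_zero.1 h'
  exact NoZeroDivisors.to_isDomain T

theorem setup (hS : IsSkewPolynomialRing α.toRingEquiv φ θ)
    (hX : IsLocalRing.maximalIdeal R = Ideal.span {X})
    (hres : Function.Bijective ((IsLocalRing.residue R).comp (algebraMap k R)))
    {T : Type u} [Ring T] [IsDomain S] [IsDomain T] {ψ : S →+* T}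
    (hT : IsLocalizationAt (φ X) ψ) :
    letI := algS hS
    Setup (φ X) (piA hS hres) ψ (deg hS) := by
  letI := algS hS
  have hX0 : X ≠ 0 := (irr hX).ne_zero
  have hφ : Function.Injective φ := by
    intro a b hab
    have h1 := congrArg (cp hS) hab
    rw [cp_phi, cp_phi] at h1
    exact Polynomial.C_injective h1
  refine
    { surj := ?_
      kerL := kerL hS hX hres
      kerR := kerR hS hX hres
      piX := ?_
      X0 := ?_
      val := ?_
      dmul := deg_mul hS
      dunit := ?_
      inj := hT.inj
      unit := hT.unit
      locR := hT.surj
      locL := locL hS hX hres hT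
      euL := euL hS hX
      euR := euR hS hX }
  · intro p
    exact ⟨_, piR_theta hS hres p⟩
  · show piR hS hres (φ X) = 0
    rw [piR_phi, (rho_dvd hX hres X).2 dvd_rfl, Polynomial.C_0]
  · exact (map_ne_zero_iff φ hφ).2 hX0
  · intro s hs
    have h1 := lc_ne hS hs
    have h2 : FiniteMultiplicity X ((cp hS s).coeff (cp hS s).natDegree) :=
      FiniteMultiplicity.of_not_isUnit (irr hX).not_isUnit h1
    obtain ⟨n, hn⟩ := h2
    refine ⟨n + 1, fun t ht => hn ⟨(cp hS t).coeff (cp hS s).natDegree, ?_⟩⟩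
    conv_lhs => rw [ht]
    rw [← map_pow, coeff_phi_mul, map_pow, ← ht]
  · intro s h1 h2
    have h3 := Polynomial.eq_C_of_natDegree_eq_zero h2
    have h4 : s = φ ((cp hS s).coeff 0) := by
      apply (cp hS).injective
      rw [cp_phi, ← h3]
    rw [h4]
    apply IsUnit.map
    by_contra h5
    apply h1
    show piR hS hres s = 0
    rw [h4, piR_phi, (rho_zero hres _).2 h5, Polynomial.C_0]

theorem hinf (hS : IsSkewPolynomialRing α.toRingEquiv φ θ)
    (hX : IsLocalRing.maximalIdeal R = Ideal.span {X})
    (hres : Function.Bijective ((IsLocalRing.residue R).comp (algebraMap k R)))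
    (p : Polynomial k) (hp : p ≠ 0) :
    letI := algS hS
    ∃ (n : ℕ) (u : S), IsUnit u ∧ Polynomial.aeval (φ X) p = φ X ^ n * u := by
  letI := algS hS
  obtain ⟨q, hq, h0⟩ := Polynomial.exists_eq_pow_rootMultiplicity_mul_and_not_dvd p hp 0
  rw [Polynomial.C_0, sub_zero] at hq h0
  have hr : IsUnit (Polynomial.aeval X q) := by
    by_contra h
    rw [← rho_zero hres] at h
    apply h0
    rw [Polynomial.X_dvd_iff, Polynomial.coeff_zero_eq_eval_zero]
    rw [Polynomial.aeval_def, Polynomial.hom_eval₂, (rho_dvd hX hres X).2 dvd_rfl] at h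
    have : (rho hres).comp (algebraMap k R) = RingHom.id k := by
      ext c; exact rho_alg hres c
    rw [this] at h; exact h
  refine ⟨p.rootMultiplicity 0, φ (Polynomial.aeval X q), hr.map φ, ?_⟩
  have h5 : Polynomial.aeval (φ X) p = φ (Polynomial.aeval X p) := by
    rw [Polynomial.aeval_def, Polynomial.aeval_def, Polynomial.hom_eval₂]; rfl
  rw [h5]
  conv_lhs => rw [hq]
  rw [map_mul, map_pow, Polynomial.aeval_X, map_mul, map_pow]

end
end SkewAux

theorem typ_op {k S : Type u} [Field k] [Ring S] [Algebra k S] (π : S →ₐ[k] Polynomial k)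
    (δ : Prop) (z : S) :
    Typ (π.fromOpposite (fun _ _ => mul_comm _ _)) δ (op z) ↔ Typ π δ z := by
  unfold Typ
  have h1 : Irreducible (op z) ↔ Irreducible z := by
    constructor
    · intro h
      rw [irreducible_iff]
      refine ⟨fun hu => h.not_isUnit (by simpa using hu), ?_⟩
      rintro a b rfl
      have := h.isUnit_or_isUnit (a := op b) (b := op a) (by simp)
      simpa [or_comm] using this
    · intro h
      rw [irreducible_iff]
      refine ⟨fun hu => h.not_isUnit (by simpa using hu), ?_⟩
      intro a b hab
      have := h.isUnit_or_isUnit (a := unop b) (b := unop a) (op_injective (by simpa using hab))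
      simpa [or_comm] using this
  rw [h1]; rfl

/-- the right regular module is the left regular module of the opposite ring -/
def opE (T : Type u) [Ring T] : T ≃ₗ[Tᵐᵒᵖ] Tᵐᵒᵖ where
  toFun := op
  invFun := unop
  left_inv _ := rfl
  right_inv _ := rfl
  map_add' _ _ := rfl
  map_smul' _ _ := rfl

/-- right quotients are left quotients over the opposite ring -/
noncomputable def rQuotE (T : Type u) [Ring T] (z : T) :
    rQuot T z ≃ₗ[Tᵐᵒᵖ] lQuot Tᵐᵒᵖ (op z) :=
  Submodule.Quotient.equiv _ _ (opE T) (by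
    rw [rSpan, lSpan, Submodule.map_span, Set.image_singleton]; rfl)

namespace SkewAux
section
variable {k : Type u} [Field k]
    {R : Type u} [CommRing R] [IsDomain R] [IsDiscreteValuationRing R] [Algebra k R]
    {X : R} {α : R ≃ₐ[k] R} {S : Type u} [Ring S] {φ : R →+* S} {θ : S}

theorem typeB_iff (hS : IsSkewPolynomialRing α.toRingEquiv φ θ)
    (hX : IsLocalRing.maximalIdeal R = Ideal.span {X})
    (hres : Function.Bijective ((IsLocalRing.residue R).comp (algebraMap k R))) (b : S) :
    letI := algS hS
    Typ (piA hS hres) True b ↔ Irreducible b ∧ IsTypeB X φ b := by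
  letI := algS hS
  have hpX : piR hS hres (φ X) = 0 := by
    rw [piR_phi, (rho_dvd hX hres X).2 dvd_rfl, Polynomial.C_0]
  constructor
  · rintro ⟨hi, -, h⟩
    refine ⟨hi, ?_⟩
    have hu : IsUnit (piR hS hres b) := h.2 trivial
    obtain ⟨c, hc, hcb⟩ := Polynomial.isUnit_iff.1 hu
    have hc0 : c ≠ 0 := hc.ne_zero
    have hun : IsUnit (φ (algebraMap k R c⁻¹)) :=
      ((IsUnit.mk0 _ (inv_ne_zero hc0)).map (algebraMap k R)).map φ
    obtain ⟨u, hu'⟩ := hun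
    obtain ⟨s, hs⟩ := kerL hS hX hres (u * b - 1) (by
      rw [hu', map_sub, map_mul, piR_phi, rho_alg, ← hcb, ← Polynomial.C_mul,
        inv_mul_cancel₀ hc0, Polynomial.C_1, map_one, sub_self])
    have hs' : (u : S) * b = 1 + φ X * s := by rw [← hs]; abel
    refine ⟨u, s, ?_, hs'⟩
    rintro ⟨r, rfl⟩
    apply hi.not_isUnit
    have h1 : IsUnit (1 + X * r) := by
      by_contra h1
      rw [← rho_zero hres, map_add, map_mul, (rho_dvd hX hres X).2 dvd_rfl, zero_mul, map_one,
        add_zero] at h1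
      exact one_ne_zero h1
    have h2 := h1.map φ
    rw [map_add, map_mul, map_one, ← hs'] at h2
    exact (Units.isUnit_units_mul u b).1 h2
  · rintro ⟨hi, u, s, -, h⟩
    have h1 : piR hS hres u * piR hS hres b = 1 := by
      rw [← map_mul, h, map_add, map_mul, hpX, zero_mul, add_zero, map_one]
    have h2 : IsUnit (piR hS hres b) := IsUnit.of_mul_eq_one_right _ h1
    exact ⟨hi, h2.ne_zero, fun _ => trivial, fun _ => h2⟩

theorem typeC_iff (hS : IsSkewPolynomialRing α.toRingEquiv φ θ)
    (hX : IsLocalRing.maximalIdeal R = Ideal.span {X})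
    (hres : Function.Bijective ((IsLocalRing.residue R).comp (algebraMap k R))) (c : S) :
    letI := algS hS
    Typ (piA hS hres) False c ↔ Irreducible c ∧ IsTypeC k X φ θ c := by
  letI := algS hS
  have := domS hS
  have hpX : piR hS hres (φ X) = 0 := by
    rw [piR_phi, (rho_dvd hX hres X).2 dvd_rfl, Polynomial.C_0]
  have hX0 : φ X ≠ 0 := by
    intro h
    have h1 := congrArg (cp hS) h
    rw [cp_phi, map_zero, Polynomial.C_eq_zero] at h1
    exact (irr hX).ne_zero h1
  constructor
  · rintro ⟨hi, h0, h⟩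
    refine ⟨hi, ?_⟩
    replace h0 : piR hS hres c ≠ 0 := h0
    have hu : ¬ IsUnit (piR hS hres c) := fun h' => h.1 h'
    set P := piR hS hres c with hP
    have hl : P.leadingCoeff ≠ 0 := Polynomial.leadingCoeff_ne_zero.2 h0
    have hun : IsUnit (φ (algebraMap k R P.leadingCoeff⁻¹)) :=
      ((IsUnit.mk0 _ (inv_ne_zero hl)).map (algebraMap k R)).map φ
    obtain ⟨u, hu'⟩ := hun
    have hpu : piR hS hres (u * c) = Polynomial.C P.leadingCoeff⁻¹ * P := by
      rw [hu', map_mul, piR_phi, rho_alg]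
    obtain ⟨s, hs⟩ := kerL hS hX hres (u * c - thetaPoly φ θ (Polynomial.C P.leadingCoeff⁻¹ * P)) (by
      rw [map_sub, hpu, piR_theta, sub_self])
    have hs' : (u : S) * c = thetaPoly φ θ (Polynomial.C P.leadingCoeff⁻¹ * P) + φ X * s := by
      rw [← hs]; abel
    have hmon : (Polynomial.C P.leadingCoeff⁻¹ * P).Monic := by
      rw [mul_comm]; exact Polynomial.monic_mul_leadingCoeff_inv h0
    have hdeg : 1 ≤ (Polynomial.C P.leadingCoeff⁻¹ * P).natDegree := by
      rw [Polynomial.natDegree_C_mul (inv_ne_zero hl)]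
      by_contra hd
      have hd0 : P.natDegree = 0 := by omega
      apply hu
      rw [Polynomial.isUnit_iff_degree_eq_zero]
      rw [Polynomial.degree_eq_natDegree h0, hd0]; rfl
    by_cases hθ : (u : S) * c = θ
    · have h1 : IsUnit (1 + X) := by
        by_contra h1
        rw [← rho_zero hres, map_add, (rho_dvd hX hres X).2 dvd_rfl, map_one,
          add_zero] at h1
        exact one_ne_zero h1
      obtain ⟨v, hv⟩ := h1.map φ
      have hvu : ((v * u : Sˣ) : S) * c = u * c + φ X * (u * c) := by
        rw [Units.val_mul, hv, map_add, map_one, mul_assoc, add_mul, one_mul]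
      refine ⟨v * u, _, s + u * c, hmon, hdeg, ?_, ?_⟩
      · rw [hvu, mul_add, ← add_assoc, ← hs']
      · intro h2
        rw [hvu, hθ, add_eq_left, ← hθ] at h2
        exact mul_ne_zero hX0 (mul_ne_zero u.ne_zero hi.ne_zero) h2
    · exact ⟨u, _, s, hmon, hdeg, hs', hθ⟩
  · rintro ⟨hi, u, p, s, hm, hd, h, -⟩
    have h1 : piR hS hres u * piR hS hres c = p := by
      rw [← map_mul, h, map_add, map_mul, hpX, zero_mul, add_zero, piR_theta]
    have h0 : piR hS hres c ≠ 0 := by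
      intro h0
      rw [h0, mul_zero] at h1
      exact hm.ne_zero h1.symm
    refine ⟨hi, h0, fun hu => ?_, False.elim⟩
    have h2 : IsUnit p := by
      rw [← h1]; exact (u.isUnit.map (piR hS hres)).mul hu
    have := Polynomial.natDegree_eq_zero_of_isUnit h2
    omega

end
end SkewAux

open SkewAux in
/-- The following are equivalent: (a) `S` satisfies right `(◊)`;
(b) there is no uniserial right `T`-module of composition length 2 whose socle is a
type (B) simple module and whose simple image is of type (C); (c) there is no uniserial
left `T`-module of composition length 2 whose socle is a type (C) simple module and
whose simple image is of type (B); (d) there is no cyclic 1-critical left `S`-module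
with an infinite-dimensional simple image; (e) for all irreducible `b, c ∈ S` with `b`
of type (B) and `c` of type (C) there are irreducible `b', c' ∈ S`, of types (B), (C)
and similar in `T` to `b`, `c` respectively, with `cb = b'c'`. -/
theorem diamond_criterion_tfae
    {k : Type u} [Field k]
    {R : Type u} [CommRing R] [IsDomain R] [IsDiscreteValuationRing R] [Algebra k R]
    (X : R) (hX : IsLocalRing.maximalIdeal R = Ideal.span {X})
    (hres : Function.Bijective ((IsLocalRing.residue R).comp (algebraMap k R)))
    (α : R ≃ₐ[k] R) (hord : ∀ n : ℕ, 0 < n → α ^ n ≠ 1)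
    {S : Type u} [Ring S] (φ : R →+* S) (θ : S)
    (hS : IsSkewPolynomialRing α.toRingEquiv φ θ)
    {T : Type u} [Ring T] (ψ : S →+* T) (hT : IsLocalizationAt (φ X) ψ) :
    List.TFAE
      [ -- (a) right (◊) for S
        HasDiamond Sᵐᵒᵖ,
        -- (b) no uniserial right T-module of length 2: socle type (B), top type (C)
        ¬ ∃ (M : Type u) (_ : AddCommGroup M) (_ : Module Tᵐᵒᵖ M)
            (N : Submodule Tᵐᵒᵖ M) (b c : S),
          (∀ A B : Submodule Tᵐᵒᵖ M, A ≤ B ∨ B ≤ A) ∧ N ≠ ⊥ ∧ N ≠ ⊤ ∧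
          IsSimpleModule Tᵐᵒᵖ N ∧ IsSimpleModule Tᵐᵒᵖ (M ⧸ N) ∧
          Irreducible b ∧ IsTypeB X φ b ∧ Nonempty (↥N ≃ₗ[Tᵐᵒᵖ] rQuot T (ψ b)) ∧
          Irreducible c ∧ IsTypeC k X φ θ c ∧
          Nonempty ((M ⧸ N) ≃ₗ[Tᵐᵒᵖ] rQuot T (ψ c)),
        -- (c) no uniserial left T-module of length 2: socle type (C), top type (B)
        ¬ ∃ (M : Type u) (_ : AddCommGroup M) (_ : Module T M)
            (N : Submodule T M) (b c : S),
          (∀ A B : Submodule T M, A ≤ B ∨ B ≤ A) ∧ N ≠ ⊥ ∧ N ≠ ⊤ ∧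
          IsSimpleModule T N ∧ IsSimpleModule T (M ⧸ N) ∧
          Irreducible c ∧ IsTypeC k X φ θ c ∧ Nonempty (↥N ≃ₗ[T] lQuot T (ψ c)) ∧
          Irreducible b ∧ IsTypeB X φ b ∧ Nonempty ((M ⧸ N) ≃ₗ[T] lQuot T (ψ b)),
        -- (d) no cyclic 1-critical left S-module with infinite-dimensional simple image
        ¬ ∃ (M : Type u) (_ : AddCommGroup M) (_ : Module S M),
          (∃ m : M, Submodule.span S {m} = ⊤) ∧ IsOneCritical S M ∧
          ∃ N : Submodule S M, IsSimpleModule S (M ⧸ N) ∧ ¬ FinDimOverLeft k φ (M ⧸ N),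
        -- (e) monoid commutativity of types (B) and (C)
        ∀ b c : S, Irreducible b → IsTypeB X φ b → Irreducible c → IsTypeC k X φ θ c →
          ∃ b' c' : S, Irreducible b' ∧ IsTypeB X φ b' ∧ SimilarIn T (ψ b') (ψ b) ∧
            Irreducible c' ∧ IsTypeC k X φ θ c' ∧ SimilarIn T (ψ c') (ψ c) ∧
            c * b = b' * c' ] := by
  have hdS := domS hS
  have hdT := domT hS hX hres hT
  letI := algS hS
  have H := setup hS hX hres hT
  have Ho := H.toOp
  have hnf : (¬ False) = True := by simp
  have hnt : (¬ True) = False := by simp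
  have hB := typeB_iff hS hX hres
  have hC := typeC_iff hS hX hres
  have hop := fac_op (piA hS hres) (β := False) (γ := True) (by simp)
  have ha : HasDiamond Sᵐᵒᵖ ↔ Fac (piA hS hres) False :=
    ⟨fun h => hop.1 (Ho.diamond_fac h), fun h => Ho.fac_diamond (hop.2 h)⟩
  have hb := (Ho.uniserial_iff True).trans hop
  have hc := H.uniserial_iff False
  refine List.tfae_of_forall (Fac (piA hS hres) False) _ ?_
  refine List.forall_mem_cons.2 ⟨ha, List.forall_mem_cons.2 ⟨?_, List.forall_mem_cons.2 ⟨?_,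
    List.forall_mem_cons.2 ⟨?_, List.forall_mem_cons.2 ⟨?_, List.forall_mem_nil _⟩⟩⟩⟩⟩
  · rw [← hb, not_iff_not]
    constructor
    · rintro ⟨M, _, _, N, b, c, h1, h2, h3, h4, h5, h6, h7, ⟨e⟩, h9, h10, ⟨f⟩⟩
      refine ⟨M, _, _, N, op b, op c, h1, h2, h3, h4, h5,
        (typ_op _ _ _).2 ((hB b).2 ⟨h6, h7⟩), ⟨e.trans (rQuotE T (ψ b))⟩,
        (typ_op _ _ _).2 ?_, ⟨f.trans (rQuotE T (ψ c))⟩⟩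
      rw [hnt]; exact (hC c).2 ⟨h9, h10⟩
    · rintro ⟨M, _, _, N, b, c, h1, h2, h3, h4, h5, h6, ⟨e⟩, h9, ⟨f⟩⟩
      have h6' := (hB (unop b)).1 ((typ_op _ _ _).1 h6)
      rw [hnt] at h9
      have h9' := (hC (unop c)).1 ((typ_op _ _ _).1 h9)
      exact ⟨M, _, _, N, unop b, unop c, h1, h2, h3, h4, h5, h6'.1, h6'.2,
        ⟨e.trans (rQuotE T (ψ (unop b))).symm⟩, h9'.1, h9'.2,
        ⟨f.trans (rQuotE T (ψ (unop c))).symm⟩⟩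
  · rw [← hc, not_iff_not]
    constructor
    · rintro ⟨M, _, _, N, b, c, h1, h2, h3, h4, h5, h6, h7, e, h9, h10, f⟩
      refine ⟨M, _, _, N, c, b, h1, h2, h3, h4, h5, (hC c).2 ⟨h6, h7⟩, e, ?_, f⟩
      rw [hnf]; exact (hB b).2 ⟨h9, h10⟩
    · rintro ⟨M, _, _, N, c, b, h1, h2, h3, h4, h5, h6, e, h9, f⟩
      rw [hnf] at h9
      exact ⟨M, _, _, N, b, c, h1, h2, h3, h4, h5, ((hC c).1 h6).1, ((hC c).1 h6).2, e,
        ((hB b).1 h9).1, ((hB b).1 h9).2, f⟩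
  · constructor
    · intro hd
      exact H.d_fac (hinf hS hX hres) hd
    · rintro F ⟨M, _, _, ⟨m, hm⟩, ⟨-, h1, h2⟩, N, hN, hfd⟩
      exact hfd (H.fac_d F hm h1 h2 N hN)
  · constructor
    · intro h c b hc hb
      rw [hnf] at hb ⊢
      obtain ⟨b', c', h1, h2, -, h3, h4, -, h5⟩ := h b c ((hB b).1 hb).1 ((hB b).1 hb).2
        ((hC c).1 hc).1 ((hC c).1 hc).2
      exact ⟨b', c', (hB b').2 ⟨h1, h2⟩, (hC c').2 ⟨h3, h4⟩, h5⟩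
    · intro F b c h1 h2 h3 h4
      have tb := (hB b).2 ⟨h1, h2⟩
      have tc := (hC c).2 ⟨h3, h4⟩
      obtain ⟨b', c', tb', tc', h5⟩ := F c b tc (by rw [hnf]; exact tb)
      rw [hnf] at tb'
      obtain ⟨⟨e⟩, ⟨f⟩⟩ := Ho.sim (β := True) (p := op b) (p' := op b') (q := op c) (q' := op c')
        ((typ_op _ _ _).2 tb) ((typ_op _ _ _).2 tb')
        ((typ_op _ _ _).2 (by rw [hnt]; exact tc)) ((typ_op _ _ _).2 (by rw [hnt]; exact tc'))
        (by rw [← op_mul, ← op_mul, h5])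
      refine ⟨b', c', ((hB b').1 tb').1, ((hB b').1 tb').2, ?_, ((hC c').1 tc').1,
        ((hC c').1 tc').2, ?_, h5⟩
      · exact ⟨(rQuotE T (ψ b')).trans (e.trans (rQuotE T (ψ b)).symm)⟩
      · exact ⟨(rQuotE T (ψ c')).trans (f.trans (rQuotE T (ψ c)).symm)⟩
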